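/- arXiv:2510.15057 — 5 statements merged into one kernel-verified Lean document; each statement's English description precedes it below -/
import Mathlib

section
/- As x → 0⁺, the stationary density satisfies the higher-order asymptotic expansion log φ(x) = (1/(2 log λ)) (log x)² − (1/log λ) (log x)·log log(1/x) + O(log x); that is, there exist C > 0 and δ ∈ (0, x₀') such that for all x ∈ (0, δ), |log φ(x) − ((1/(2 log λ)) (log x)² − (1/log λ) (log x)·log log(1/x))| ≤ C |log x|. -/
open MeasureTheory Filter Set

lemma cmp_deriv {u v u' v' : ℝ → ℝ} {a x : ℝ} (hax : a ≤ x)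
    (hu : ∀ y ∈ Icc a x, HasDerivAt u (u' y) y) (hv : ∀ y ∈ Icc a x, HasDerivAt v (v' y) y)
    (hle : ∀ y ∈ Icc a x, u' y ≤ v' y) (h0 : u a ≤ v a) : u x ≤ v x := by
  have hd : ∀ y ∈ Icc a x, HasDerivAt (fun z => v z - u z) (v' y - u' y) y :=
    fun y hy => (hv y hy).sub (hu y hy)
  have hm : MonotoneOn (fun z => v z - u z) (Icc a x) := by
    apply monotoneOn_of_deriv_nonneg (convex_Icc a x)
    · exact fun y hy => (hd y hy).continuousAt.continuousWithinAt
    · exact fun y hy => (hd y (interior_subset hy)).differentiableAt.differentiableWithinAt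
    · intro y hy
      rw [(hd y (interior_subset hy)).deriv]
      linarith [hle y (interior_subset hy)]
  have := hm (left_mem_Icc.2 hax) (right_mem_Icc.2 hax) hax
  simp only at this
  linarith

noncomputable def cf (q lam : ℝ) (n : ℕ) : ℝ := q ^ n / (lam ^ (n.choose 2) * (n.factorial : ℝ))

lemma cf_succ {q lam : ℝ} (n : ℕ) :
    cf q lam (n+1) = q * cf q lam n / (lam ^ n * ((n:ℝ) + 1)) := by
  unfold cf
  have : (n+1).choose 2 = n + n.choose 2 := by
    rw [Nat.choose_succ_succ' n 1, Nat.choose_one_right]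
  rw [this, Nat.factorial_succ, pow_succ, pow_add]
  push_cast
  simp only [div_eq_mul_inv, mul_inv]
  ring

lemma cf_pos {q lam : ℝ} (hq : 0 < q) (hl : 0 < lam) (n : ℕ) : 0 < cf q lam n := by
  unfold cf; positivity

lemma cf_zero {q lam : ℝ} : cf q lam 0 = 1 := by simp [cf]

lemma cf_mul {q lam t : ℝ} (n : ℕ) : cf q lam n * t ^ n = cf (q * t) lam n := by
  unfold cf; rw [mul_pow]; ring

lemma upper_bd {lam A r r0 r1 b : ℝ} {h φ Φ : ℝ → ℝ} (hl0 : 0 < lam) (hl1 : lam < 1)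
    (hA : 0 < A) (hr : r = r1 / 2) (hr1 : 0 < r1) (hr10 : r1 ≤ r0)
    (hAr : A * r0 ≤ 1/4) (hb : 0 < b)
    (hΦ : ∀ x, HasDerivAt Φ (φ x) x) (hΦ0 : Φ 0 = 0) (hΦm : Monotone Φ)
    (h1 : ∀ x ∈ Icc 0 r1, h x ∈ Icc 0 r0)
    (h2 : ∀ x ∈ Icc 0 r1, h x - A * (h x)^2 ≤ (x - A * x^2) / lam)
    (h4 : ∀ x ∈ Icc 0 r1, φ x ≤ b * Φ (h x)) (n : ℕ) :
    ∀ x ∈ Icc 0 r0, x - A * x^2 ≤ lam ^ n * r →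
      Φ x ≤ Φ r0 * cf (2*b) lam n * (x - A * x^2)^n := by
  have hω : ∀ x ∈ Icc 0 r0, x / 2 ≤ x - A * x^2 := by
    intro x ⟨hx0, hx⟩
    have : A * x ≤ 1/4 := le_trans (by gcongr) hAr
    nlinarith
  have hM : 0 ≤ Φ r0 := by rw [← hΦ0]; exact hΦm (by linarith)
  induction n with
  | zero => intro x hx _; rw [cf_zero]; simpa using hΦm hx.2
  | succ n ih =>
    intro x hx hxr
    have hpn : lam ^ n ≤ 1 := pow_le_one₀ hl0.le hl1.le
    have hpn1 : lam ^ (n+1) ≤ 1 := pow_le_one₀ hl0.le hl1.le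
    have hxr1 : x ≤ r1 := by
      have := hω x hx
      have : lam^(n+1) * r ≤ 1 * r := by gcongr; rw [hr]; positivity
      linarith
    have hc := cf_pos (q := 2*b) (by positivity) hl0 n
    refine cmp_deriv (u := Φ) (u' := φ)
      (v := fun y => Φ r0 * cf (2*b) lam (n+1) * (y - A * y^2)^(n+1))
      (v' := fun y => Φ r0 * cf (2*b) lam (n+1) * (((n+1 : ℕ):ℝ) * (y - A * y^2)^n * (1 - A * (2 * y))))
      hx.1 (fun y _ => hΦ y) ?_ ?_ ?_
    · intro y _
      apply HasDerivAt.const_mul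
      have h5 : HasDerivAt (fun y : ℝ => y - A * y^2) (1 - A * (2*y)) y := by
        simpa using (hasDerivAt_id' y).fun_sub ((hasDerivAt_pow 2 y).const_mul A)
      simpa using h5.fun_pow (n+1)
    · intro y hy
      have hy1 : y ∈ Icc 0 r1 := ⟨hy.1, hy.2.trans hxr1⟩
      have hy0 : y ∈ Icc 0 r0 := ⟨hy.1, hy.2.trans hx.2⟩
      have hyω : 0 ≤ y - A * y^2 := by linarith [hω y hy0, hy.1]
      have hhω : 0 ≤ h y - A * (h y)^2 := by linarith [hω _ (h1 y hy1), (h1 y hy1).1]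
      have hmono : y - A * y^2 ≤ x - A * x^2 := by
        have : A * x ≤ 1/4 := le_trans (by gcongr; exact hx.2) hAr
        have : A * y ≤ 1/4 := le_trans (by gcongr; exact hy0.2) hAr
        nlinarith [hy.2]
      have hAy : A * y ≤ 1/4 := le_trans (by gcongr; exact hy0.2) hAr
      have hdom : h y - A * (h y)^2 ≤ lam ^ n * r := by
        refine (h2 y hy1).trans ?_
        rw [div_le_iff₀ hl0]
        calc _ ≤ _ := hmono.trans hxr
          _ = _ := by ring
      calc φ y ≤ b * Φ (h y) := h4 y hy1
        _ ≤ b * (Φ r0 * cf (2*b) lam n * (h y - A * (h y)^2)^n) := by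
            gcongr; exact ih _ (h1 y hy1) hdom
        _ ≤ b * (Φ r0 * cf (2*b) lam n * ((y - A * y^2)/lam)^n) := by
            gcongr; exact h2 y hy1
        _ = Φ r0 * cf (2*b) lam (n+1) * (((n+1 : ℕ):ℝ) * (y - A * y^2)^n * (1/2)) := by
            rw [cf_succ, div_pow]; push_cast; field_simp
        _ ≤ _ := by
            have := cf_pos (q := 2*b) (by positivity) hl0 (n+1)
            gcongr; linarith
    · simp [hΦ0]

lemma lower_bd {lam A r s m r0 r1 a : ℝ} {h φ Φ : ℝ → ℝ} (hl0 : 0 < lam) (hl1 : lam < 1)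
    (hA : 0 < A) (hr : r = r1 / 2) (hr1 : 0 < r1) (hr10 : r1 ≤ r0)
    (hAr : A * r0 ≤ 1/4) (ha : 0 < a) (hs : 0 < s) (hm : m = Φ (s/2)) (hm0 : 0 < m)
    (hΦ : ∀ x, HasDerivAt Φ (φ x) x) (hΦ0 : Φ 0 = 0) (hΦm : Monotone Φ)
    (h1 : ∀ x ∈ Icc 0 r1, h x ∈ Icc 0 r0)
    (h2 : ∀ x ∈ Icc 0 r1, h x - A * (h x)^2 ≤ (x - A * x^2) / lam)
    (h3 : ∀ x ∈ Icc 0 r1, (x + A * x^2) / lam ≤ h x + A * (h x)^2)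
    (h4 : ∀ x ∈ Icc 0 r1, a * Φ (h x) ≤ φ x) (n : ℕ) :
    ∀ x ∈ Icc 0 r0, x - A * x^2 ≤ lam ^ n * r → s * lam ^ n ≤ x + A * x^2 → 
      m * cf (a/2) lam n * (x + A * x^2 - s * lam ^ n)^n ≤ Φ x := by
  have hω : ∀ x ∈ Icc 0 r0, x / 2 ≤ x - A * x^2 := by
    intro x ⟨hx0, hx⟩
    have : A * x ≤ 1/4 := le_trans (by gcongr) hAr
    nlinarith
  induction n with
  | zero => 
    intro x hx _ hxs; rw [cf_zero, hm]; 
    simp only [pow_zero, mul_one] at *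
    apply hΦm 
    have : A * x ≤ 1/4 := le_trans (by gcongr; exact hx.2) hAr
    nlinarith [hx.1]
  | succ n ih =>
    intro x hx hxr hxs
    have hpn1 : lam ^ (n+1) ≤ 1 := pow_le_one₀ hl0.le hl1.le
    have hsp : 0 < s * lam^(n+1) := by positivity
    have hxr1 : x ≤ r1 := by
      have := hω x hx
      have : lam^(n+1) * r ≤ 1 * r := by gcongr; rw [hr]; positivity
      linarith
    have hc := cf_pos (q := a/2) (by positivity) hl0 n
    obtain ⟨x1, hx1, hx1e⟩ : ∃ x1 ∈ Icc 0 x, x1 + A * x1^2 = s * lam^(n+1) := by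
      have := intermediate_value_Icc hx.1 (f := fun x => x + A * x^2) (by fun_prop)
      exact this ⟨by simpa using hsp.le, hxs⟩
    refine cmp_deriv (v := Φ) (v' := φ) (a := x1)
      (u := fun y => m * cf (a/2) lam (n+1) * (y + A * y^2 - s * lam^(n+1))^(n+1))
      (u' := fun y => m * cf (a/2) lam (n+1) * (((n+1 : ℕ):ℝ) * (y + A * y^2 - s * lam^(n+1))^n * (1 + A * (2 * y))))
      hx1.2 ?_ (fun y _ => hΦ y) ?_ ?_
    · intro y _
      apply HasDerivAt.const_mul
      have h5 : HasDerivAt (fun y : ℝ => y + A * y^2 - s * lam^(n+1)) (1 + A * (2*y)) y := by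
        simpa using ((hasDerivAt_id' y).fun_add ((hasDerivAt_pow 2 y).const_mul A)).sub_const (s * lam^(n+1))
      simpa using h5.fun_pow (n+1)
    · intro y hy
      have hyn : 0 ≤ y := hx1.1.trans hy.1
      have hy1 : y ∈ Icc 0 r1 := ⟨hyn, hy.2.trans hxr1⟩
      have hy0 : y ∈ Icc 0 r0 := ⟨hyn, hy.2.trans hx.2⟩
      have hAy : A * y ≤ 1/4 := le_trans (by gcongr; exact hy0.2) hAr
      have hmono : y - A * y^2 ≤ x - A * x^2 := by
        have : A * x ≤ 1/4 := le_trans (by gcongr; exact hx.2) hAr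
        nlinarith [hy.2]
      have hys : s * lam^(n+1) ≤ y + A * y^2 := by
        rw [← hx1e]
        have := hy.1
        have := hx1.1
        gcongr
      have hdom : h y - A * (h y)^2 ≤ lam ^ n * r := by
        refine (h2 y hy1).trans ?_
        rw [div_le_iff₀ hl0]
        calc _ ≤ _ := hmono.trans hxr
          _ = _ := by ring
      have hkey : (y + A * y^2 - s * lam^(n+1)) / lam ≤ h y + A * (h y)^2 - s * lam^n := by
        have := h3 y hy1
        have e : (y + A * y^2 - s * lam^(n+1)) / lam = (y + A*y^2)/lam - s * lam^n := by
          field_simp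
          ring
        linarith
      have hnn : 0 ≤ (y + A * y^2 - s * lam^(n+1)) / lam := div_nonneg (by linarith) hl0.le
      have hnn' : 0 ≤ (y + A * y^2 - s * lam^(n+1)) := by linarith
      calc m * cf (a/2) lam (n+1) * (((n+1 : ℕ):ℝ) * (y + A * y^2 - s * lam^(n+1))^n * (1 + A * (2 * y)))
          ≤ m * cf (a/2) lam (n+1) * (((n+1 : ℕ):ℝ) * (y + A * y^2 - s * lam^(n+1))^n * 2) := by
            have := cf_pos (q := a/2) (by positivity) hl0 (n+1)
            gcongr; linarith
        _ = a * (m * cf (a/2) lam n * ((y + A * y^2 - s * lam^(n+1)) / lam)^n) := by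
            rw [cf_succ, div_pow]; push_cast; field_simp
        _ ≤ a * (m * cf (a/2) lam n * (h y + A * (h y)^2 - s * lam^n)^n) := by
            gcongr
        _ ≤ a * Φ (h y) := by
            gcongr; exact ih _ (h1 y hy1) hdom (by linarith)
        _ ≤ φ y := h4 y hy1
    · simp only [hx1e, sub_self]
      rw [zero_pow (by omega), mul_zero, ← hΦ0]; exact hΦm hx1.1

lemma log_cf {K q lam x : ℝ} (hK : 0 < K) (hq : 0 < q) (hl : 0 < lam) (hx : 0 < x) (n : ℕ) :
    Real.log (K * cf q lam n * x^n) = Real.log K + n * Real.log q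
      - (n * (n - 1) / 2) * Real.log lam - Real.log n.factorial + n * Real.log x := by
  have := cf_pos hq hl n
  rw [Real.log_mul (by positivity) (by positivity), Real.log_mul (by positivity) (by positivity)]
  unfold cf
  rw [Real.log_div (by positivity) (by positivity), Real.log_mul (by positivity) (by positivity),
    Real.log_pow, Real.log_pow, Real.log_pow, Nat.cast_choose_two]
  ring

lemma log_fact_le (n : ℕ) : Real.log n.factorial ≤ n * Real.log n := by
  rw [← Real.log_pow]
  exact Real.log_le_log (by positivity) (by exact_mod_cast Nat.factorial_le_pow n)

lemma le_log_fact (n : ℕ) (hn : 0 < n) : n * Real.log n - n ≤ Real.log n.factorial := by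
  have h : (n:ℝ)^n / n.factorial ≤ Real.exp n := Real.pow_div_factorial_le_exp _ (by positivity) n
  have h2 := Real.log_le_log (by positivity) h
  rw [Real.log_exp, Real.log_div (by positivity) (by positivity), Real.log_pow] at h2
  linarith

lemma final_est {kap : ℝ} (hk : 0 < kap) (k0 q0 c : ℝ) (hc : 0 < c) :
    ∃ C > 0, ∀ L : ℝ, 1 ≤ L → 2 * c ≤ L → ∀ n : ℕ, |L - kap * n| ≤ c →
      |k0 + n * q0 + (n * ((n:ℝ) - 1) / 2) * kap - Real.log n.factorial - n * L
        - (-(L^2) / (2*kap) - L * Real.log L / kap)| ≤ C * L := by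
  set D := |Real.log (2 * kap)| + |Real.log (2 * kap / 3)| with hD
  refine ⟨|k0| + 2/kap * |q0| + 1 + c^2/(2*kap) + c/kap + 2/kap * D + 2/kap, by positivity, ?_⟩
  intro L hL hcL n hn
  rw [abs_le] at hn
  have hn1 : kap * n ≤ 3/2 * L := by linarith
  have hn2 : L/2 ≤ kap * n := by linarith
  have hn0 : 0 < (n:ℝ) := by
    by_contra hcon
    nlinarith
  have hnat : 0 < n := by exact_mod_cast hn0
  have hnL : (n:ℝ) ≤ 2/kap * L := by
    rw [div_mul_eq_mul_div, le_div_iff₀ hk]; nlinarith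
  have f1 := log_fact_le n
  have f2 := le_log_fact n hnat
  have hlogL0 : 0 ≤ Real.log L := Real.log_nonneg hL
  have hlogL : Real.log L ≤ L := (Real.log_le_sub_one_of_pos (by linarith)).trans (by linarith)
  have g1 : Real.log L - Real.log n ≤ Real.log (2*kap) := by
    rw [← Real.log_div (by positivity) (by positivity)]
    apply Real.log_le_log (by positivity)
    rw [div_le_iff₀ hn0]; linarith
  have g2 : Real.log (2*kap/3) ≤ Real.log L - Real.log n := by
    rw [← Real.log_div (by positivity) (by positivity)]
    apply Real.log_le_log (by positivity)
    rw [le_div_iff₀ hn0]; linarith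
  have g3 : |Real.log L - Real.log n| ≤ D := by
    rw [abs_le]
    constructor
    · linarith [neg_abs_le (Real.log (2*kap/3)), abs_nonneg (Real.log (2*kap))]
    · linarith [le_abs_self (Real.log (2*kap)), abs_nonneg (Real.log (2*kap/3))]
  have e : k0 + n * q0 + (n * ((n:ℝ) - 1) / 2) * kap - Real.log n.factorial - n * L
        - (-(L^2) / (2*kap) - L * Real.log L / kap) =
      k0 + n * q0 + (-(kap * n / 2)) + (L - kap*n)^2/(2*kap) + (L - kap * n) / kap * Real.log L
        + n * (Real.log L - Real.log n) + (n * Real.log n - Real.log n.factorial) := by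
    field_simp
    ring
  rw [e]
  have b1 : |k0| ≤ |k0| * L := le_mul_of_one_le_right (abs_nonneg _) hL
  have b2 : |(n:ℝ) * q0| ≤ 2/kap * |q0| * L := by
    rw [abs_mul, Nat.abs_cast]; nlinarith [abs_nonneg q0]
  have b3 : |(-(kap * n / 2))| ≤ 1 * L := by
    rw [abs_neg, abs_of_nonneg (by positivity)]; linarith
  have b4 : |(L - kap*n)^2/(2*kap)| ≤ c^2/(2*kap) * L := by
    rw [abs_of_nonneg (by positivity)]
    calc _ ≤ c^2/(2*kap) := div_le_div_of_nonneg_right (sq_le_sq' hn.1 hn.2) (by positivity)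
      _ ≤ _ := le_mul_of_one_le_right (by positivity) hL
  have b5 : |(L - kap * n) / kap * Real.log L| ≤ c/kap * L := by
    rw [abs_mul, abs_div, abs_of_pos hk, abs_of_nonneg hlogL0]
    gcongr; exact abs_le.2 hn
  have b6 : |n * (Real.log L - Real.log n)| ≤ 2/kap * D * L := by
    rw [abs_mul, Nat.abs_cast]
    calc _ ≤ (2/kap * L) * D := by gcongr
      _ = _ := by ring
  have b7 : |(n * Real.log n - Real.log n.factorial)| ≤ 2/kap * L := by
    rw [abs_le]; constructor <;> linarith
  rw [abs_le] at *
  constructor <;> linarith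

set_option maxHeartbeats 2000000 in
lemma core {lam A r0 r1 a b x0 : ℝ} {h φ Φ : ℝ → ℝ} (hl0 : 0 < lam) (hl1 : lam < 1)
    (hx0 : 0 < x0)
    (hA : 0 < A) (hr1 : 0 < r1) (hr10 : r1 ≤ r0)
    (hAr : A * r0 ≤ 1/4) (ha : 0 < a) (hb : 0 < b)
    (hΦ : ∀ x, HasDerivAt Φ (φ x) x) (hΦ0 : Φ 0 = 0) (hΦm : Monotone Φ)
    (hΦpos : ∀ x, 0 < x → 0 < Φ x)
    (h1 : ∀ x ∈ Icc 0 r1, h x ∈ Icc 0 r0)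
    (h2 : ∀ x ∈ Icc 0 r1, h x - A * (h x)^2 ≤ (x - A * x^2) / lam)
    (h3 : ∀ x ∈ Icc 0 r1, (x + A * x^2) / lam ≤ h x + A * (h x)^2)
    (h4 : ∀ x ∈ Icc 0 r1, a * Φ (h x) ≤ φ x)
    (h4' : ∀ x ∈ Icc 0 r1, φ x ≤ b * Φ (h x)) :
    ∃ C > 0, ∃ δ ∈ Set.Ioo (0:ℝ) x0, ∀ x ∈ Set.Ioo (0:ℝ) δ,
      |Real.log (φ x) - ((1 / (2 * Real.log lam)) * (Real.log x) ^ 2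
          - (1 / Real.log lam) * Real.log x * Real.log (Real.log (1/x)))|
        ≤ C * |Real.log x| := by
  set kap := -Real.log lam with hkap
  have hk : 0 < kap := by have := Real.log_neg hl0 hl1; linarith
  set r := r1 / 2 with hr
  have hrp : 0 < r := by positivity
  set s := lam * r / 2 with hs
  have hsp : 0 < s := by positivity
  set m := Φ (s/2) with hm
  have hmp : 0 < m := hΦpos _ (by positivity)
  have hMp : 0 < Φ r0 := hΦpos _ (by linarith)
  have hU := upper_bd hl0 hl1 hA hr hr1 hr10 hAr hb hΦ hΦ0 hΦm h1 h2 h4'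
  have hL := lower_bd hl0 hl1 hA hr hr1 hr10 hAr ha hsp hm hmp hΦ hΦ0 hΦm h1 h2 h3 h4
  set c := 2 * kap + |Real.log r| + Real.log 2 with hc
  have hlog2 : 0 < Real.log 2 := Real.log_pos (by norm_num)
  have hcp : 0 < c := by positivity
  obtain ⟨C1, hC1, H1⟩ := final_est hk (Real.log (b * Φ r0)) (Real.log (2*b*(1/lam))) c hcp
  obtain ⟨C2, hC2, H2⟩ := final_est hk (Real.log (a * m)) (Real.log (a/2*(1/(2*lam)))) c hcp
  set δ := min (x0/2) (min (lam * r) (min (Real.exp (-1)) (Real.exp (-(2*c))))) with hδ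
  refine ⟨C1 + C2, by positivity, δ, ⟨by positivity, ?_⟩, ?_⟩
  · exact (min_le_left _ _).trans_lt (by linarith)
  intro x ⟨hxp, hxδ⟩
  simp only [hδ, lt_min_iff] at hxδ
  obtain ⟨-, hx1, hx2, hx3⟩ := hxδ
  have hxr1 : x ≤ r1 := by nlinarith
  have hxI : x ∈ Icc 0 r1 := ⟨hxp.le, hxr1⟩
  have hAx : A * x ≤ 1/4 := le_trans (by gcongr; linarith) hAr
  have hω1 : x/2 ≤ x - A * x^2 := by nlinarith
  have hω2 : x - A * x^2 ≤ x := by nlinarith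
  have hωp : 0 < x - A*x^2 := by linarith
  obtain ⟨n, hn1, hn2⟩ : ∃ n : ℕ, lam ^ (n+1) < (x - A*x^2)/(lam*r) ∧ (x - A*x^2)/(lam*r) ≤ lam ^ n :=
    exists_nat_pow_near_of_lt_one (by positivity)
      (by rw [div_le_one (by positivity)]; linarith) hl0 hl1
  rw [lt_div_iff₀ (by positivity)] at hn1
  rw [div_le_iff₀ (by positivity)] at hn2
  have hhx := h1 x hxI
  have hhω : 0 ≤ h x - A * (h x)^2 := by
    have : A * h x ≤ 1/4 := le_trans (by gcongr; exact hhx.2) hAr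
    nlinarith [hhx.1]
  have hdom : h x - A * (h x)^2 ≤ lam ^ n * r := by
    refine (h2 x hxI).trans ?_
    rw [div_le_iff₀ hl0]; linarith
  have hws : s * lam^n * lam ≤ (x + A * x^2)/2 := by
    have : s * lam^n * lam = lam^(n+1) * (lam * r)/2 := by rw [hs]; ring
    have : 0 ≤ A * x^2 := by positivity
    linarith
  have hlow : (1/(2*lam)) * x ≤ h x + A * (h x)^2 - s * lam^n := by
    have h5 := h3 x hxI
    have h6 : s * lam^n ≤ (x + A*x^2)/2/lam := by rw [le_div_iff₀ hl0]; linarith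
    have h7 : (1/(2*lam)) * x ≤ (x + A*x^2)/2/lam := by
      have : (1/(2*lam)) * x = x/2/lam := by field_simp
      rw [this]; gcongr; nlinarith
    have h8 : (x + A*x^2)/lam = (x + A*x^2)/2/lam + (x + A*x^2)/2/lam := by ring
    linarith
  have hlp : 0 < (1/(2*lam)) * x := by positivity
  have up : φ x ≤ b * Φ r0 * cf (2*b*(1/lam)) lam n * x^n := by
    have := cf_pos (q := 2*b) (by positivity) hl0 n
    calc φ x ≤ b * Φ (h x) := h4' x hxI
      _ ≤ b * (Φ r0 * cf (2*b) lam n * (h x - A * (h x)^2)^n) := by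
          gcongr; exact hU n _ hhx hdom
      _ ≤ b * (Φ r0 * cf (2*b) lam n * (1/lam * x)^n) := by
          gcongr
          refine (h2 x hxI).trans ?_
          rw [one_div_mul_eq_div]; gcongr
      _ = _ := by rw [← cf_mul (q := 2*b) (t := 1/lam), mul_pow]; ring
  have lo : a * m * cf (a/2*(1/(2*lam))) lam n * x^n ≤ φ x := by
    have := cf_pos (q := a/2) (by positivity) hl0 n
    calc _ = a * (m * cf (a/2) lam n * ((1/(2*lam)) * x)^n) := by rw [← cf_mul (q := a/2) (t := 1/(2*lam)), mul_pow]; ring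
      _ ≤ a * (m * cf (a/2) lam n * (h x + A * (h x)^2 - s * lam^n)^n) := by gcongr
      _ ≤ a * Φ (h x) := by gcongr; exact hL n _ hhx hdom (by linarith)
      _ ≤ _ := h4 x hxI
  have hlopos : 0 < a * m * cf (a/2*(1/(2*lam))) lam n * x^n := by
    have := cf_pos (q := a/2*(1/(2*lam))) (by positivity) hl0 n
    positivity
  have hup := Real.log_le_log (hlopos.trans_le lo) up
  have hlo := Real.log_le_log hlopos lo
  rw [log_cf (by positivity) (by positivity) hl0 hxp] at hup hlo
  set L := -Real.log x with hLdef
  have hlx : Real.log x = -L := by rw [hLdef]; ring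
  have hll : Real.log lam = -kap := by rw [hkap]; ring
  have hL1 : 1 ≤ L := by
    have := Real.log_lt_log hxp hx2
    rw [Real.log_exp] at this; linarith
  have hL2 : 2 * c ≤ L := by
    have := Real.log_lt_log hxp hx3
    rw [Real.log_exp] at this; linarith
  have hLn : |L - kap * n| ≤ c := by
    have e1 := Real.log_lt_log (by positivity) hn1
    have e2 := Real.log_le_log hωp hn2
    have e3 := Real.log_le_log hωp hω2
    have e4 := Real.log_le_log (by positivity) hω1
    rw [Real.log_mul (by positivity) (by positivity), Real.log_mul (by positivity) (by positivity), Real.log_pow, hll] at e1 e2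
    rw [Real.log_div (by positivity) (by positivity)] at e4
    push_cast at e1
    rw [hlx] at e3 e4
    rw [abs_le, hc]
    constructor
    · linarith [le_abs_self (Real.log r), abs_nonneg (Real.log r)]
    · linarith [neg_abs_le (Real.log r)]
  have K1 := H1 L hL1 hL2 n hLn
  have K2 := H2 L hL1 hL2 n hLn
  have hT : (1 / (2 * Real.log lam)) * (Real.log x) ^ 2
          - (1 / Real.log lam) * Real.log x * Real.log (Real.log (1/x)) =
      (-(L^2) / (2*kap) - L * Real.log L / kap) := by
    rw [one_div x, Real.log_inv, ← hLdef, hlx, hll]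
    field_simp
  rw [hT, hlx, abs_neg, abs_of_pos (by linarith : 0 < L)]
  rw [hlx, hll] at hup hlo
  rw [abs_le] at *
  have p1 : 0 ≤ C1 * L := mul_nonneg hC1.le (by linarith)
  have p2 : 0 ≤ C2 * L := mul_nonneg hC2.le (by linarith)
  constructor <;> linarith

lemma taylor_h {h : ℝ → ℝ} {l : ℝ} (hh : ContDiff ℝ 2 h) (h0 : h 0 = 0) (hd : HasDerivAt h l 0) :
    ∃ C > 0, ∀ x ∈ Icc (0:ℝ) 1, |h x - l * x| ≤ C * x^2 := by
  obtain ⟨C, hC⟩ := exists_taylor_mean_remainder_bound (f := h) (a := 0) (b := 1) (n := 1)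
    zero_le_one (by exact_mod_cast hh.contDiffOn)
  refine ⟨|C| + 1, by positivity, fun x hx => ?_⟩
  have := hC x hx
  rw [taylorWithinEval_succ, taylor_within_zero_eval, iteratedDerivWithin_one,
    (hd.hasDerivWithinAt).derivWithin (uniqueDiffOn_Icc zero_lt_one 0 (by simp))] at this
  simp [h0] at this
  rw [mul_comm l x]
  refine this.trans ?_
  have : C ≤ |C| + 1 := by linarith [le_abs_self C]
  gcongr

theorem stmt_0
    (ε : ℝ) (hε : 0 < ε)
    (f g : ℝ → ℝ)
    (hf : ContDiff ℝ 2 f) (hg : ContDiff ℝ 2 g)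
    (hfmono : StrictMono f)
    (hgf : Function.LeftInverse g f) (hfg : Function.RightInverse g f)
    (fm fminv : ℝ → ℝ)
    (hfm : ∀ x, fm x = f x - ε)
    (hfminv : ∀ x, fminv x = g (x + ε))
    (hfm0 : fm 0 = 0)
    (lam : ℝ) (hlam : lam = deriv fm 0) (hlam0 : 0 < lam) (hlam1 : lam < 1)
    (p : ℝ → ℝ) (hp : ContDiffOn ℝ 1 p (Set.Icc (-ε) ε))
    (hpnn : ∀ z ∈ Set.Icc (-ε) ε, 0 ≤ p z) (hpe : 0 < p (-ε))
    (x₀' : ℝ) (hx₀' : 0 < x₀')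
    (φ : ℝ → ℝ) (hφc : Continuous φ) (hφnn : ∀ x, 0 ≤ φ x)
    (hφpos : ∀ x ∈ Set.Ioc 0 x₀', 0 < φ x)
    (hstat : ∀ x ∈ Set.Icc 0 x₀',
      φ x = (1/ε) * ∫ y in (0:ℝ)..(fminv x), p (x - f y) * φ y)
    (hderivmono : MonotoneOn (deriv fm) (Set.Icc 0 x₀') ∨
      AntitoneOn (deriv fm) (Set.Icc 0 x₀')) :
    ∃ C > 0, ∃ δ ∈ Set.Ioo (0:ℝ) x₀', ∀ x ∈ Set.Ioo (0:ℝ) δ,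
      |Real.log (φ x) - ((1 / (2 * Real.log lam)) * (Real.log x) ^ 2
          - (1 / Real.log lam) * Real.log x * Real.log (Real.log (1/x)))|
        ≤ C * |Real.log x| := by
  have hf0 : f 0 = ε := by have := hfm 0; linarith
  have hh0 : fminv 0 = 0 := by rw [hfminv, zero_add, ← hf0, hgf]
  have hfmh : ∀ x, f (fminv x) = x + ε := fun x => by rw [hfminv, hfg]
  have hhC : ContDiff ℝ 2 fminv := by
    have : fminv = fun x => g (x + ε) := funext hfminv
    rw [this]; fun_prop
  have hhnn : ∀ x, 0 ≤ x → 0 ≤ fminv x := by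
    intro x hx
    rw [← hfmono.le_iff_le, hfmh, hf0]; linarith
  have hhd : HasDerivAt fminv (1/lam) 0 := by
    have d1 : HasDerivAt fminv (deriv fminv 0) 0 := (hhC.differentiable (by norm_num) 0).hasDerivAt
    have d2 : HasDerivAt fm lam (fminv 0) := by
      rw [hh0, hlam]
      have : fm = fun x => f x - ε := funext hfm
      rw [this]
      exact ((hf.differentiable (by norm_num) 0).sub_const ε).hasDerivAt
    have d3 : HasDerivAt (fm ∘ fminv) (lam * deriv fminv 0) 0 := d2.comp 0 d1
    have e : fm ∘ fminv = id := by
      funext x; simp [hfm, hfmh]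
    rw [e] at d3
    have := d3.unique (hasDerivAt_id 0)
    have e2 : 1/lam = deriv fminv 0 := by rw [div_eq_iff hlam0.ne']; linarith
    rw [e2]; exact d1
  obtain ⟨C, hC, hT⟩ := taylor_h hhC hh0 hhd
  have hpc := hp.continuousOn
  obtain ⟨η, hη, hpη⟩ : ∃ η > 0, ∀ z ∈ Icc (-ε) ε, z < -ε + η →
      p (-ε) / 2 ≤ p z ∧ p z ≤ 2 * p (-ε) := by
    have hmem : (-ε) ∈ Icc (-ε) ε := ⟨le_rfl, by linarith⟩
    obtain ⟨η, hη, H⟩ := Metric.continuousWithinAt_iff.1 (hpc _ hmem) (p (-ε) / 2) (by positivity)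
    refine ⟨η, hη, fun z hz hzη => ?_⟩
    have := H hz (by rw [Real.dist_eq, abs_lt]; constructor <;> linarith [hz.1])
    rw [Real.dist_eq, abs_lt] at this
    constructor <;> linarith
  set Φ : ℝ → ℝ := fun x => ∫ y in (0:ℝ)..x, φ y with hΦdef
  have hΦ : ∀ x, HasDerivAt Φ (φ x) x := fun x => hφc.integral_hasStrictDerivAt 0 x |>.hasDerivAt
  have hΦ0 : Φ 0 = 0 := by simp [hΦdef]
  have hΦm : Monotone Φ := monotone_of_deriv_nonneg (fun x => (hΦ x).differentiableAt)
    (fun x => by rw [(hΦ x).deriv]; exact hφnn x)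
  have hΦpos : ∀ x, 0 < x → 0 < Φ x := by
    intro x hx
    refine lt_of_lt_of_le ?_ (hΦm (min_le_left x x₀'))
    apply intervalIntegral.intervalIntegral_pos_of_pos_on (hφc.intervalIntegrable _ _)
    · intro y hy
      exact hφpos y ⟨hy.1, hy.2.le.trans (min_le_right _ _)⟩
    · positivity
  set ρ := min x₀' (min (η/2) ε) with hρ
  have hρp : 0 < ρ := by positivity
  have hφb : ∀ x ∈ Icc 0 ρ, p (-ε) / (2*ε) * Φ (fminv x) ≤ φ x ∧
      φ x ≤ 2 * p (-ε) / ε * Φ (fminv x) := by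
    intro x ⟨hx0, hxρ⟩
    simp only [hρ, le_min_iff] at hxρ
    obtain ⟨hxa, hxb, hxc⟩ := hxρ
    have hnn := hhnn x hx0
    have hz : ∀ y ∈ Icc 0 (fminv x), x - f y ∈ Icc (-ε) ε ∧ x - f y < -ε + η := by
      intro y hy
      have i1 : ε ≤ f y := by rw [← hf0]; exact hfmono.monotone hy.1
      have i2 : f y ≤ x + ε := by rw [← hfmh]; exact hfmono.monotone hy.2
      exact ⟨⟨by linarith, by linarith⟩, by linarith⟩
    have hint : IntervalIntegrable (fun y => p (x - f y) * φ y) volume 0 (fminv x) := by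
      apply ContinuousOn.intervalIntegrable
      rw [uIcc_of_le hnn]
      apply ContinuousOn.mul _ hφc.continuousOn
      exact hpc.comp (continuous_const.sub hf.continuous).continuousOn (fun y hy => (hz y hy).1)
    rw [hstat x ⟨hx0, hxa⟩]
    have j1 : ∫ y in (0:ℝ)..(fminv x), p (-ε)/2 * φ y ≤ ∫ y in (0:ℝ)..(fminv x), p (x - f y) * φ y := by
      apply intervalIntegral.integral_mono_on hnn ((hφc.intervalIntegrable _ _).const_mul _) hint
      intro y hy
      have := (hpη _ (hz y hy).1 (hz y hy).2).1
      exact mul_le_mul_of_nonneg_right this (hφnn y)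
    have j2 : ∫ y in (0:ℝ)..(fminv x), p (x - f y) * φ y ≤ ∫ y in (0:ℝ)..(fminv x), 2 * p (-ε) * φ y := by
      apply intervalIntegral.integral_mono_on hnn hint ((hφc.intervalIntegrable _ _).const_mul _)
      intro y hy
      have := (hpη _ (hz y hy).1 (hz y hy).2).2
      exact mul_le_mul_of_nonneg_right this (hφnn y)
    rw [intervalIntegral.integral_const_mul] at j1 j2
    constructor
    · calc _ = 1/ε * (p (-ε)/2 * Φ (fminv x)) := by field_simp
        _ ≤ _ := by gcongr
    · calc _ ≤ 1/ε * (2 * p (-ε) * Φ (fminv x)) := by gcongr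
        _ = _ := by field_simp
  set A := 2 * C * lam^2 / (1 - lam) with hAdef
  have h1l : 0 < 1 - lam := by linarith
  have hA : 0 < A := by positivity
  have hAe : A * (1 / lam)^2 - A * (1/lam) = 2 * C := by
    rw [hAdef]; field_simp
  set r0 := 1/(4*A) with hr0
  have hr0p : 0 < r0 := by positivity
  set r1 := min ρ (min 1 (min r0 (min (r0/(1/lam + C)) (lam/(2*A))))) with hr1
  have hr1p : 0 < r1 := by positivity
  have key : ∀ x ∈ Icc 0 r1, x ∈ Icc 0 ρ ∧ x ∈ Icc 0 1 ∧ x * (1/lam + C) ≤ r0 ∧ 2 * A * x * (1/lam) ≤ 1 := by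
    intro x ⟨hx0, hx⟩
    simp only [hr1, le_min_iff] at hx
    obtain ⟨q1, q2, q3, q4, q5⟩ := hx
    refine ⟨⟨hx0, q1⟩, ⟨hx0, q2⟩, ?_, ?_⟩
    · rwa [le_div_iff₀ (by positivity)] at q4
    · rw [le_div_iff₀ (by positivity)] at q5
      rw [mul_one_div, div_le_one hlam0]; linarith
  have hsq : ∀ x ∈ Icc 0 r1, A * (1/lam)^2 * x^2 - C * x^2 ≤ A * (fminv x)^2 := by
    intro x hx
    obtain ⟨-, k2, -, k4⟩ := key x hx
    have t := abs_le.1 (hT x k2)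
    set l := 1/lam
    have hlp : 0 < l := by positivity
    have t1 : (l*x)^2 + 2 * (l * x) * (fminv x - l * x) ≤ (fminv x)^2 := by
      nlinarith [sq_nonneg (fminv x - l * x)]
    have t2 : (l*x)^2 - 2 * (l * x) * (C * x^2) ≤ (fminv x)^2 := by
      have : 0 ≤ 2 * (l*x) := by have := k2.1; positivity
      nlinarith
    have t3 := mul_le_mul_of_nonneg_left t2 hA.le
    have t4 : 2 * A * x * l * (C * x^2) ≤ 1 * (C * x^2) := by gcongr
    nlinarith
  refine core (h := fminv) (Φ := Φ) (r0 := r0) (r1 := r1) (a := p (-ε) / (2*ε)) (b := 2 * p (-ε) / ε) hlam0 hlam1 hx₀' hA hr1p ?_ ?_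
    (by positivity) (by positivity) hΦ hΦ0 hΦm hΦpos ?_ ?_ ?_ ?_ ?_
  · simp [hr1]
  · rw [hr0]; apply le_of_eq; field_simp
  · intro x hx
    obtain ⟨k1, k2, k3, k4⟩ := key x hx
    refine ⟨hhnn x hx.1, ?_⟩
    have t := abs_le.1 (hT x k2)
    have : C * x^2 ≤ C * x := by nlinarith [k2.1, k2.2, mul_nonneg hC.le k2.1]
    nlinarith
  · intro x hx
    obtain ⟨k1, k2, k3, k4⟩ := key x hx
    have t := abs_le.1 (hT x k2)
    have u := hsq x hx
    have e : (x - A*x^2)/lam = 1/lam * x - A * (1/lam) * x^2 := by ring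
    rw [e]
    have : (A * (1 / lam)^2 - A * (1/lam)) * x^2 = 2 * C * x^2 := by rw [hAe]
    linarith
  · intro x hx
    obtain ⟨k1, k2, k3, k4⟩ := key x hx
    have t := abs_le.1 (hT x k2)
    have u := hsq x hx
    have e : (x + A*x^2)/lam = 1/lam * x + A * (1/lam) * x^2 := by ring
    rw [e]
    have : (A * (1 / lam)^2 - A * (1/lam)) * x^2 = 2 * C * x^2 := by rw [hAe]
    linarith
  · exact fun x hx => (hφb x (key x hx).1).1
  · exact fun x hx => (hφb x (key x hx).1).2
end

section
/- As x → 0⁺, the stationary density satisfies the leading-order asymptotic law log φ(x) = (1/(2 log λ)) (log x)² + o((log x)²); equivalently, log φ(x) / (log x)² → 1/(2 log λ) as x → 0⁺. -/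
open MeasureTheory Filter Set

lemma iter_bound (v : ℝ → ℝ) (α A s L0 M : ℝ) (hα : 0 < α)
    (hb : ∀ L, L0 - α ≤ L → L ≤ L0 → v L ≤ M)
    (hrec : ∀ L, L0 ≤ L → v L ≤ A + s * L + v (L - α)) :
    ∃ B D, ∀ L, L0 - α ≤ L → v L ≤ s * L ^ 2 / (2 * α) + B * L + D := by
  set K : ℝ := |A + s * α / 2| with hK
  have hK0 : 0 ≤ K := abs_nonneg _
  have hK1 : A + s * α / 2 ≤ K := le_abs_self _
  set M' : ℝ := M + |s| * (|L0| + α) ^ 2 / (2 * α) with hM'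
  have key : ∀ n : ℕ, ∀ L, L0 - α ≤ L → L ≤ L0 + n * α →
      v L - s * L ^ 2 / (2 * α) ≤ M' + K / α * (L - L0 + α) := by
    intro n
    induction n with
    | zero =>
      intro L h1 h2
      simp only [Nat.cast_zero, zero_mul, add_zero] at h2
      have h3 := hb L h1 h2
      have h4 : |L| ≤ |L0| + α := by
        rw [abs_le]
        constructor
        · linarith [neg_abs_le L0]
        · linarith [le_abs_self L0]
      have h5 : -(s * L ^ 2) ≤ |s| * (|L0| + α) ^ 2 := by
        calc -(s * L ^ 2) ≤ |s * L ^ 2| := neg_le_abs _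
          _ = |s| * |L| ^ 2 := by rw [abs_mul, abs_pow]
          _ ≤ _ := by gcongr
      have h6 : -(s * L ^ 2) / (2 * α) ≤ |s| * (|L0| + α) ^ 2 / (2 * α) := by gcongr
      rw [neg_div] at h6
      have h7 : 0 ≤ K / α * (L - L0 + α) := mul_nonneg (by positivity) (by linarith)
      linarith
    | succ n ih =>
      intro L h1 h2
      by_cases h : L ≤ L0 + n * α
      · exact ih L h1 h
      · push Not at h
        push_cast at h2
        have hn : 0 ≤ (n : ℝ) * α := by positivity
        have h3 := ih (L - α) (by linarith) (by linarith)
        have h4 := hrec L (by linarith)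
        have h5 : s * L ^ 2 / (2 * α) = s * (L - α) ^ 2 / (2 * α) + s * L - s * α / 2 := by
          field_simp
          ring
        have h6 : K / α * (L - L0 + α) = K / α * (L - α - L0 + α) + K := by
          field_simp
          ring
        linarith
  refine ⟨K / α, M' + K / α * (-L0 + α), ?_⟩
  intro L hL
  obtain ⟨n, hn⟩ := exists_nat_ge ((L - L0) / α)
  rw [div_le_iff₀ hα] at hn
  have := key n L hL (by linarith)
  linarith

lemma iter_asymp (v q : ℝ → ℝ) (α A A₁ s L0 M : ℝ) (hα : 0 < α)
    (hb : ∀ L, L0 - α ≤ L → L ≤ L0 → v L ≤ M)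
    (hrec : ∀ L, L0 ≤ L → v L ≤ A + s * L + v (L - α))
    (hq : ∀ L, L0 ≤ L → q L ≤ A₁ + v (L - α)) (t : ℝ) (ht : s / (2 * α) < t) :
    ∀ᶠ L in atTop, q L / L ^ 2 < t := by
  obtain ⟨B, D, h⟩ := iter_bound v α A s L0 M hα hb hrec
  have hlim : Tendsto (fun L : ℝ => s / (2 * α) + (B - s) * L⁻¹
      + (A₁ + s * α / 2 - B * α + D) * (L⁻¹ * L⁻¹)) atTop (nhds (s / (2 * α))) := by
    have h0 : Tendsto (fun L : ℝ => L⁻¹) atTop (nhds 0) := tendsto_inv_atTop_zero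
    have := ((tendsto_const_nhds (x := s / (2 * α))).add (h0.const_mul (B - s))).add
      ((h0.mul h0).const_mul (A₁ + s * α / 2 - B * α + D))
    simpa using this
  filter_upwards [hlim.eventually_lt_const ht, eventually_ge_atTop L0, eventually_gt_atTop 0]
    with L h1 h2 h3
  refine lt_of_le_of_lt ?_ h1
  have h4 := hq L h2
  have h5 := h (L - α) (by linarith)
  rw [div_le_iff₀ (by positivity)]
  have h6 : (s / (2 * α) + (B - s) * L⁻¹
      + (A₁ + s * α / 2 - B * α + D) * (L⁻¹ * L⁻¹)) * L ^ 2
      = A₁ + (s * (L - α) ^ 2 / (2 * α) + B * (L - α) + D) := by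
    field_simp
    ring
  rw [h6]
  linarith

/-- Abstract two-sided comparison in terms of the primitive. -/
lemma upper_asymp (φ Φ : ℝ → ℝ) (C a δ : ℝ) (hC : 0 < C) (ha : 1 < a) (hδ : 0 < δ)
    (hmono : Monotone Φ) (hpos : ∀ x, 0 < x → 0 < Φ x)
    (hφpos : ∀ x, 0 < x → x ≤ δ → 0 < φ x)
    (h1 : ∀ x, 0 < x → x ≤ δ → φ x ≤ C * Φ (a * x))
    (h2 : ∀ x, 0 < x → x ≤ δ → Φ x ≤ C * x * Φ (a * x))
    (t : ℝ) (ht : -1 / (2 * Real.log a) < t) :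
    ∀ᶠ L in atTop, Real.log (φ (Real.exp (-L))) / L ^ 2 < t := by
  have ha0 : 0 < a := by linarith
  have hexp : ∀ L, Real.exp (-(L - Real.log a)) = a * Real.exp (-L) := by
    intro L
    rw [neg_sub, sub_eq_add_neg, Real.exp_add, Real.exp_log ha0]
  have hle : ∀ L, -Real.log δ ≤ L → Real.exp (-L) ≤ δ := by
    intro L hL
    rw [← Real.le_log_iff_exp_le hδ]; linarith
  refine iter_asymp (fun L => Real.log (Φ (Real.exp (-L))))
    (fun L => Real.log (φ (Real.exp (-L)))) (Real.log a) (Real.log C) (Real.log C) (-1)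
    (-Real.log δ) (Real.log (Φ (a * δ))) (Real.log_pos ha) ?_ ?_ ?_ t ht
  · intro L hL _
    apply Real.log_le_log (hpos _ (Real.exp_pos _))
    apply hmono
    rw [← Real.le_log_iff_exp_le (by positivity), Real.log_mul ha0.ne' hδ.ne']
    linarith
  · intro L hL
    have := Real.log_le_log (hpos _ (Real.exp_pos _)) (h2 _ (Real.exp_pos _) (hle L hL))
    rw [Real.log_mul (by positivity) (hpos _ (by positivity)).ne',
      Real.log_mul hC.ne' (Real.exp_pos _).ne', Real.log_exp] at this
    simp only [hexp]
    linarith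
  · intro L hL
    have := Real.log_le_log (hφpos _ (Real.exp_pos _) (hle L hL))
      (h1 _ (Real.exp_pos _) (hle L hL))
    rw [Real.log_mul (by positivity) (hpos _ (by positivity)).ne'] at this
    simp only [hexp]
    linarith

lemma lower_asymp (φ Φ : ℝ → ℝ) (C a δ : ℝ) (hC : 0 < C) (ha : 1 < a) (hδ : 0 < δ)
    (hmono : Monotone Φ) (hpos : ∀ x, 0 < x → 0 < Φ x)
    (h1 : ∀ x, 0 < x → x ≤ δ → C * Φ (a * x) ≤ φ x)
    (h2 : ∀ x, 0 < x → x ≤ δ → C * x * Φ (a * x) ≤ Φ x)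
    (t : ℝ) (ht : 1 / (2 * Real.log a) < t) :
    ∀ᶠ L in atTop, -Real.log (φ (Real.exp (-L))) / L ^ 2 < t := by
  have ha0 : 0 < a := by linarith
  have hexp : ∀ L, Real.exp (-(L - Real.log a)) = a * Real.exp (-L) := by
    intro L
    rw [neg_sub, sub_eq_add_neg, Real.exp_add, Real.exp_log ha0]
  have hle : ∀ L, -Real.log δ ≤ L → Real.exp (-L) ≤ δ := by
    intro L hL
    rw [← Real.le_log_iff_exp_le hδ]; linarith
  refine iter_asymp (fun L => -Real.log (Φ (Real.exp (-L))))
    (fun L => -Real.log (φ (Real.exp (-L)))) (Real.log a) (-Real.log C) (-Real.log C) 1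
    (-Real.log δ) (-Real.log (Φ δ)) (Real.log_pos ha) ?_ ?_ ?_ t ht
  · intro L _ hL
    apply neg_le_neg
    apply Real.log_le_log (hpos _ hδ)
    apply hmono
    rw [← Real.log_le_iff_le_exp hδ]
    linarith
  · intro L hL
    have := Real.log_le_log (mul_pos (mul_pos hC (Real.exp_pos _)) (hpos _ (by positivity)))
      (h2 _ (Real.exp_pos _) (hle L hL))
    rw [Real.log_mul (by positivity) (hpos _ (by positivity)).ne',
      Real.log_mul hC.ne' (Real.exp_pos _).ne', Real.log_exp] at this
    simp only [hexp]
    linarith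
  · intro L hL
    have := Real.log_le_log (mul_pos hC (hpos _ (by positivity)))
      (h1 _ (Real.exp_pos _) (hle L hL))
    rw [Real.log_mul (by positivity) (hpos _ (by positivity)).ne'] at this
    simp only [hexp]
    linarith

/-- The stationary relation gives two-sided bounds near zero. -/
lemma stat_bounds (ε : ℝ) (hε : 0 < ε) (f G p φ : ℝ → ℝ) (x₀' : ℝ) (hx₀' : 0 < x₀')
    (hfc : Continuous f) (hfmono : StrictMono f) (hf0 : f 0 = ε)
    (hfG : ∀ x, f (G x) = x + ε)
    (hp : ContinuousOn p (Set.Icc (-ε) ε)) (hpe : 0 < p (-ε))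
    (hφc : Continuous φ) (hφnn : ∀ x, 0 ≤ φ x)
    (hstat : ∀ x ∈ Set.Icc 0 x₀',
      φ x = (1/ε) * ∫ y in (0:ℝ)..(G x), p (x - f y) * φ y) :
    ∃ c C δ : ℝ, 0 < c ∧ 0 < C ∧ 0 < δ ∧ ∀ x, 0 < x → x ≤ δ →
      c * (∫ y in (0:ℝ)..(G x), φ y) ≤ φ x ∧ φ x ≤ C * ∫ y in (0:ℝ)..(G x), φ y := by
  have hcw : ContinuousWithinAt p (Icc (-ε) ε) (-ε) := hp _ ⟨le_refl _, by linarith⟩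
  have hev : ∀ᶠ z in nhdsWithin (-ε) (Icc (-ε) ε), p (-ε) / 2 < p z ∧ p z < 2 * p (-ε) :=
    (hcw.eventually_const_lt (by linarith)).and (hcw.eventually_lt_const (by linarith))
  rw [eventually_nhdsWithin_iff, Metric.eventually_nhds_iff] at hev
  obtain ⟨r, hr, hev⟩ := hev
  refine ⟨1 / ε * (p (-ε) / 2), 1 / ε * (2 * p (-ε)), min (min x₀' (2 * ε)) (r / 2),
    by positivity, by positivity, by positivity, ?_⟩
  intro x hx hxδ
  have hx1 : x ≤ x₀' := hxδ.trans ((min_le_left _ _).trans (min_le_left _ _))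
  have hx2 : x ≤ 2 * ε := hxδ.trans ((min_le_left _ _).trans (min_le_right _ _))
  have hx3 : x ≤ r / 2 := hxδ.trans (min_le_right _ _)
  have hG : 0 ≤ G x := by
    rw [← hfmono.le_iff_le, hf0, hfG]; linarith
  have hin : ∀ y ∈ Icc 0 (G x), x - f y ∈ Icc (-ε) ε ∧ dist (x - f y) (-ε) < r := by
    intro y hy
    have h1 := hfmono.monotone hy.1
    have h2 := hfmono.monotone hy.2
    rw [hf0] at h1
    rw [hfG] at h2
    refine ⟨⟨by linarith, by linarith⟩, ?_⟩
    rw [Real.dist_eq, abs_lt]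
    constructor <;> linarith
  have hpb : ∀ y ∈ Icc 0 (G x), p (-ε) / 2 < p (x - f y) ∧ p (x - f y) < 2 * p (-ε) :=
    fun y hy => hev (hin y hy).2 (hin y hy).1
  have hci : ContinuousOn (fun y => p (x - f y) * φ y) (Icc 0 (G x)) := by
    apply ContinuousOn.mul _ hφc.continuousOn
    exact hp.comp (by fun_prop) (fun y hy => (hin y hy).1)
  have hii : IntervalIntegrable (fun y => p (x - f y) * φ y) volume 0 (G x) := by
    apply ContinuousOn.intervalIntegrable
    rwa [uIcc_of_le hG]
  rw [hstat x ⟨hx.le, hx1⟩, mul_assoc, mul_assoc]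
  constructor
  · apply mul_le_mul_of_nonneg_left _ (by positivity)
    rw [← intervalIntegral.integral_const_mul]
    apply intervalIntegral.integral_mono_on hG _ hii
    · intro y hy
      exact mul_le_mul_of_nonneg_right (hpb y hy).1.le (hφnn y)
    · exact (hφc.const_mul _).intervalIntegrable _ _
  · apply mul_le_mul_of_nonneg_left _ (by positivity)
    rw [← intervalIntegral.integral_const_mul]
    apply intervalIntegral.integral_mono_on hG hii
    · exact (hφc.const_mul _).intervalIntegrable _ _
    · intro y hy
      exact mul_le_mul_of_nonneg_right (hpb y hy).2.le (hφnn y)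

lemma slope_bounds (G : ℝ → ℝ) (d : ℝ) (hG : HasDerivAt G d 0) (hG0 : G 0 = 0)
    (b a : ℝ) (hb : b < d) (ha : d < a) :
    ∃ δ, 0 < δ ∧ ∀ x, 0 < x → x ≤ δ → b * x ≤ G x ∧ G x ≤ a * x := by
  have h := hG.tendsto_slope_zero_right
  have hev := (h.eventually_const_lt hb).and (h.eventually_lt_const ha)
  rw [eventually_nhdsWithin_iff, Metric.eventually_nhds_iff] at hev
  obtain ⟨r, hr, hev⟩ := hev
  refine ⟨r / 2, by positivity, fun x hx hxr => ?_⟩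
  have := @hev x (by rw [Real.dist_eq, abs_lt]; constructor <;> linarith) hx
  simp only [zero_add, hG0, sub_zero, smul_eq_mul] at this
  rw [inv_mul_eq_div, lt_div_iff₀ hx, div_lt_iff₀ hx] at this
  exact ⟨this.1.le, this.2.le⟩

theorem stmt_1
    (ε : ℝ) (hε : 0 < ε)
    (f g : ℝ → ℝ)
    (hf : ContDiff ℝ 2 f) (hg : ContDiff ℝ 2 g)
    (hfmono : StrictMono f)
    (hgf : Function.LeftInverse g f) (hfg : Function.RightInverse g f)
    (fm fminv : ℝ → ℝ)
    (hfm : ∀ x, fm x = f x - ε)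
    (hfminv : ∀ x, fminv x = g (x + ε))
    (hfm0 : fm 0 = 0)
    (lam : ℝ) (hlam : lam = deriv fm 0) (hlam0 : 0 < lam) (hlam1 : lam < 1)
    (p : ℝ → ℝ) (hp : ContDiffOn ℝ 1 p (Set.Icc (-ε) ε))
    (hpnn : ∀ z ∈ Set.Icc (-ε) ε, 0 ≤ p z) (hpe : 0 < p (-ε))
    (x₀' : ℝ) (hx₀' : 0 < x₀')
    (φ : ℝ → ℝ) (hφc : Continuous φ) (hφnn : ∀ x, 0 ≤ φ x)
    (hφpos : ∀ x ∈ Set.Ioc 0 x₀', 0 < φ x)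
    (hstat : ∀ x ∈ Set.Icc 0 x₀',
      φ x = (1/ε) * ∫ y in (0:ℝ)..(fminv x), p (x - f y) * φ y)
    (hderivmono : MonotoneOn (deriv fm) (Set.Icc 0 x₀') ∨
      AntitoneOn (deriv fm) (Set.Icc 0 x₀')) :
    Filter.Tendsto (fun x => Real.log (φ x) / (Real.log x) ^ 2)
      (nhdsWithin 0 (Set.Ioi 0)) (nhds (1 / (2 * Real.log lam))) := by
  have hf0 : f 0 = ε := by have := hfm 0; linarith
  have hfG : ∀ x, f (fminv x) = x + ε := fun x => by rw [hfminv]; exact hfg _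
  have hG0 : fminv 0 = 0 := by rw [hfminv, zero_add, ← hf0]; exact hgf 0
  have hGd : HasDerivAt fminv (1 / lam) 0 := by
    have hfd : HasDerivAt f lam 0 := by
      have h1 : HasDerivAt f (deriv f 0) 0 := (hf.differentiable (by norm_num) 0).hasDerivAt
      have h2 : fm = fun x => f x - ε := funext hfm
      have h3 : deriv fm 0 = deriv f 0 := by rw [h2]; simp
      rwa [hlam, h3]
    have hgd : HasDerivAt g (deriv g ε) ε := (hg.differentiable (by norm_num) ε).hasDerivAt
    have hcomp : HasDerivAt (g ∘ f) (deriv g ε * lam) 0 := by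
      rw [← hf0] at hgd
      have := hgd.comp 0 hfd
      rwa [hf0] at this
    have hid : g ∘ f = id := funext hgf
    rw [hid] at hcomp
    have he : deriv g ε * lam = 1 := hcomp.unique (hasDerivAt_id 0)
    have he' : deriv g ε = 1 / lam := by rw [eq_div_iff hlam0.ne']; exact he
    rw [he'] at hgd
    have hG : fminv = fun x => g (x + ε) := funext hfminv
    rw [hG]
    apply HasDerivAt.comp_add_const
    simpa using hgd
  obtain ⟨c, C, δ₁, hc, hC, hδ₁, hcC⟩ := stat_bounds ε hε f fminv p φ x₀' hx₀' hf.continuous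
    hfmono hf0 hfG hp.continuousOn hpe hφc hφnn hstat
  set Φ : ℝ → ℝ := fun x => ∫ y in (0:ℝ)..x, φ y with hΦ
  have hint : ∀ u v, IntervalIntegrable φ volume u v := fun u v => hφc.intervalIntegrable u v
  have hmono : Monotone Φ := by
    intro u v huv
    have h1 := intervalIntegral.integral_add_adjacent_intervals (hint 0 u) (hint u v)
    have h2 : 0 ≤ ∫ y in u..v, φ y := intervalIntegral.integral_nonneg huv fun y _ => hφnn y
    simp only [hΦ]; linarith
  have hpos : ∀ x, 0 < x → 0 < Φ x := by
    intro x hx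
    have h1 : 0 < Φ (min x x₀') := by
      apply intervalIntegral.intervalIntegral_pos_of_pos_on (hint _ _) _ (lt_min hx hx₀')
      intro y hy
      exact hφpos y ⟨hy.1, hy.2.le.trans (min_le_right _ _)⟩
    exact h1.trans_le (hmono (min_le_left _ _))
  have hΦ0 : Φ 0 = 0 := by simp [hΦ]
  have hlin : 1 < 1 / lam := by rw [lt_div_iff₀ hlam0]; linarith
  have hloglam : Real.log lam < 0 := Real.log_neg hlam0 hlam1
  have hlogcont : Tendsto (fun a => 1 / (2 * Real.log a)) (nhds (1 / lam))
      (nhds (-(1 / (2 * Real.log lam)))) := by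
    have h1 : ContinuousAt (fun a => 1 / (2 * Real.log a)) (1 / lam) := by
      have h0 : (1 / lam) ≠ 0 := by positivity
      have h2 : 2 * Real.log (1 / lam) ≠ 0 := by
        have := Real.log_pos hlin
        positivity
      exact continuousAt_const.div (continuousAt_const.mul (Real.continuousAt_log h0)) h2
    have h2 := h1.tendsto
    have h3 : 1 / (2 * Real.log (1 / lam)) = -(1 / (2 * Real.log lam)) := by
      rw [one_div lam, Real.log_inv, mul_neg, div_neg]
    rwa [h3] at h2
  have hL : Tendsto (fun x => -Real.log x) (nhdsWithin 0 (Ioi 0)) atTop :=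
    tendsto_neg_atBot_atTop.comp Real.tendsto_log_nhdsGT_zero
  have hself : ∀ᶠ x : ℝ in nhdsWithin 0 (Ioi 0), 0 < x := self_mem_nhdsWithin
  rw [tendsto_order]
  constructor
  · intro t ht
    have hev := hlogcont.eventually_lt_const (show -(1 / (2 * Real.log lam)) < -t by linarith)
    have hev2 : ∀ᶠ a in nhdsWithin (1 / lam) (Iio (1 / lam)),
        1 / (2 * Real.log a) < -t ∧ 1 < a ∧ a < 1 / lam :=
      ((hev.filter_mono nhdsWithin_le_nhds).and
        ((eventually_gt_nhds hlin).filter_mono nhdsWithin_le_nhds)).and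
        self_mem_nhdsWithin |>.mono fun a h => ⟨h.1.1, h.1.2, h.2⟩
    obtain ⟨a, hat, ha1, ha2⟩ := hev2.exists
    obtain ⟨b, hab, hb⟩ := exists_between ha2
    have ha0 : 0 < a := by linarith
    have hb0 : 0 < b := by linarith
    obtain ⟨δ₂, hδ₂, hsl⟩ := slope_bounds fminv (1 / lam) hGd hG0 b (1 / lam + 1) hb (by linarith)
    have hθ : 0 < 1 - a / b := by rw [sub_pos, div_lt_one hb0]; exact hab
    have hlow : ∀ x, 0 < x → x ≤ min δ₁ δ₂ → c * Φ (b * x) ≤ φ x := by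
      intro x hx hxδ
      have h1 := (hcC x hx (hxδ.trans (min_le_left _ _))).1
      have h2 := (hsl x hx (hxδ.trans (min_le_right _ _))).1
      exact (mul_le_mul_of_nonneg_left (hmono h2) hc.le).trans h1
    have hfin := lower_asymp φ Φ (c * (1 - a / b)) a (min δ₁ δ₂) (by positivity) ha1
      (by positivity) hmono hpos ?_ ?_ (-t) hat
    · filter_upwards [hL.eventually hfin, hself] with x h hx
      rw [neg_neg, Real.exp_log hx, neg_sq, neg_div] at h
      linarith
    · intro x hx hxδ
      refine le_trans ?_ (hlow x hx hxδ)
      have h1 : Φ (a * x) ≤ Φ (b * x) := hmono (by gcongr)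
      have h2 : c * (1 - a / b) ≤ c := by
        have : 0 < a / b := by positivity
        nlinarith
      exact mul_le_mul h2 h1 (hpos _ (by positivity)).le hc.le
    · intro x hx hxδ
      have hθx : a / b * x ≤ x := by nlinarith
      have hθx0 : 0 < a / b * x := by positivity
      have h1 := intervalIntegral.integral_add_adjacent_intervals (hint 0 (a / b * x))
        (hint (a / b * x) x)
      have h2 : 0 ≤ Φ (a / b * x) := (hpos _ hθx0).le
      have h3 : ∫ y in (a / b * x)..x, c * Φ (a * x) ≤ ∫ y in (a / b * x)..x, φ y := by
        apply intervalIntegral.integral_mono_on hθx (by simp) (hint _ _)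
        intro y hy
        have hy0 : 0 < y := hθx0.trans_le hy.1
        refine le_trans ?_ (hlow y hy0 (hy.2.trans hxδ))
        apply mul_le_mul_of_nonneg_left _ hc.le
        apply hmono
        have := mul_le_mul_of_nonneg_left hy.1 hb0.le
        have he : b * (a / b * x) = a * x := by field_simp
        linarith
      rw [intervalIntegral.integral_const, smul_eq_mul] at h3
      simp only [hΦ] at h1 h2 h3 ⊢
      linarith
  · intro t ht
    have hev := hlogcont.eventually_const_lt (show -t < -(1 / (2 * Real.log lam)) by linarith)
    have hev2 : ∀ᶠ a in nhdsWithin (1 / lam) (Ioi (1 / lam)),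
        -t < 1 / (2 * Real.log a) ∧ 1 / lam < a :=
      (hev.filter_mono nhdsWithin_le_nhds).and self_mem_nhdsWithin
    obtain ⟨a, hat, ha⟩ := hev2.exists
    have ha1 : 1 < a := hlin.trans ha
    have ha0 : 0 < a := by linarith
    obtain ⟨δ₂, hδ₂, hsl⟩ := slope_bounds fminv (1 / lam) hGd hG0 0 a (by linarith) ha
    have hup : ∀ x, 0 < x → x ≤ min δ₁ δ₂ → φ x ≤ C * Φ (a * x) := by
      intro x hx hxδ
      have h1 := (hcC x hx (hxδ.trans (min_le_left _ _))).2
      have h2 := (hsl x hx (hxδ.trans (min_le_right _ _))).2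
      exact h1.trans (mul_le_mul_of_nonneg_left (hmono h2) hC.le)
    have hφ0 : φ 0 = 0 := by
      rw [hstat 0 ⟨le_refl _, hx₀'.le⟩, hG0]; simp
    have hfin := upper_asymp φ Φ C a (min (min δ₁ δ₂) x₀') hC ha1
      (by positivity) hmono hpos ?_ ?_ ?_ t (by rw [neg_div]; linarith)
    · filter_upwards [hL.eventually hfin, hself] with x h hx
      rwa [neg_neg, Real.exp_log hx, neg_sq] at h
    · intro x hx hxδ
      exact hφpos x ⟨hx, hxδ.trans (min_le_right _ _)⟩
    · intro x hx hxδ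
      exact hup x hx (hxδ.trans (min_le_left _ _))
    · intro x hx hxδ
      have hnn : 0 ≤ Φ (a * x) := (hpos _ (by positivity)).le
      have h3 : ∫ y in (0:ℝ)..x, φ y ≤ ∫ y in (0:ℝ)..x, C * Φ (a * x) := by
        apply intervalIntegral.integral_mono_on hx.le (hint _ _) (by simp)
        intro y hy
        rcases hy.1.eq_or_lt with h | h
        · rw [← h, hφ0]; positivity
        · refine (hup y h (hy.2.trans (hxδ.trans (min_le_left _ _)))).trans ?_
          apply mul_le_mul_of_nonneg_left _ hC.le
          apply hmono
          exact mul_le_mul_of_nonneg_left hy.2 ha0.le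
      rw [intervalIntegral.integral_const, smul_eq_mul] at h3
      simp only [hΦ] at h3 ⊢
      linarith
end

section
/- There exist x₀ ∈ (0, x₀') and a constant C₁ > 0 such that for every x ∈ (0, x₀), writing n = n(x) for the hitting time, the stationary density satisfies the lower bound φ(x) ≥ (C₁ⁿ / (n−1)!) · [∏_{m=2}^{n} ∏_{j=2}^{m} 1/f₋'(f₋^{−j}(x))] · ∫₀^{f₋⁻¹(x)} (f₋⁻¹(x) − y)^{n−1} φ(f₋^{−(n−1)}(y)) dy, where f₋^{−j} denotes the j-th iterate of the inverse map f₋⁻¹. -/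
open MeasureTheory Filter Set

/-- Cauchy-type formula for a repeated integral. -/
theorem aux_parts (ψ : ℝ → ℝ) (hψ : Continuous ψ) (X : ℝ) (i : ℕ) :
    ∫ y in (0:ℝ)..X, (X - y) ^ i * ∫ z in (0:ℝ)..y, ψ z
      = (1 / ((i:ℝ) + 1)) * ∫ y in (0:ℝ)..X, (X - y) ^ (i + 1) * ψ y := by
  have hi : ((i:ℝ) + 1) ≠ 0 := by positivity
  have hu : ∀ y : ℝ, HasDerivAt (fun y => -((X - y) ^ (i + 1)) / ((i:ℝ) + 1)) ((X - y) ^ i) y := by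
    intro y
    have h1 : HasDerivAt (fun y : ℝ => X - y) (-1) y := by
      simpa using (hasDerivAt_id y).const_sub X
    have h2 := ((h1.pow (i + 1)).neg).div_const ((i:ℝ) + 1)
    refine h2.congr_deriv ?_
    rw [div_eq_iff hi]
    push_cast
    simp
    ring
  have hv : ∀ y : ℝ, HasDerivAt (fun y => ∫ z in (0:ℝ)..y, ψ z) (ψ y) y := fun y =>
    intervalIntegral.integral_hasDerivAt_right (hψ.intervalIntegrable _ _)
      hψ.stronglyMeasurable.stronglyMeasurableAtFilter hψ.continuousAt
  have hcu : Continuous (fun y : ℝ => (X - y) ^ i) := by fun_prop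
  have h := intervalIntegral.integral_deriv_mul_eq_sub_of_hasDerivAt
    (u := fun y => -((X - y) ^ (i + 1)) / ((i:ℝ) + 1)) (v := fun y => ∫ z in (0:ℝ)..y, ψ z)
    (u' := fun y => (X - y) ^ i) (v' := ψ) (a := 0) (b := X)
    (fun y _ => (hu y).continuousAt.continuousWithinAt)
    (fun y _ => (hv y).continuousAt.continuousWithinAt)
    (fun y _ => hu y) (fun y _ => hv y) (hcu.intervalIntegrable _ _) (hψ.intervalIntegrable _ _)
  have hcv : Continuous (fun y => ∫ z in (0:ℝ)..y, ψ z) :=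
    continuous_iff_continuousAt.2 fun y => (hv y).continuousAt
  rw [intervalIntegral.integral_add] at h
  · have e : ∫ y in (0:ℝ)..X, -((X - y) ^ (i + 1)) / ((i:ℝ) + 1) * ψ y
        = -((1 / ((i:ℝ) + 1)) * ∫ y in (0:ℝ)..X, (X - y) ^ (i + 1) * ψ y) := by
      rw [← intervalIntegral.integral_const_mul, ← intervalIntegral.integral_neg]
      congr 1
      ext y
      ring
    rw [e] at h
    simp at h
    simp
    linarith
  · exact (hcu.mul hcv).intervalIntegrable _ _
  · apply Continuous.intervalIntegrable
    fun_prop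

theorem aux_iter_deriv (k k' : ℝ → ℝ) (hk : ∀ y, HasDerivAt k (k' y) y) (i : ℕ) (z : ℝ) :
    HasDerivAt (k^[i]) (∏ j ∈ Finset.range i, k' (k^[j] z)) z := by
  induction i with
  | zero => simpa using hasDerivAt_id z
  | succ i ih =>
    rw [Function.iterate_succ', Finset.prod_range_succ, mul_comm]
    exact (hk _).comp z ih

theorem aux_core (k k' φ : ℝ → ℝ) (hk : ∀ y, HasDerivAt k (k' y) y) (hk'c : Continuous k')
    (hk'pos : ∀ y, 0 < k' y) (hmono : StrictMono k) (hk0 : k 0 = 0)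
    (hφc : Continuous φ) (hφnn : ∀ x, 0 ≤ φ x)
    (c D x₀ x : ℝ) (hc : 0 < c) (hD : 1 ≤ D) (hx : 0 < x)
    (hφ : ∀ t ∈ Icc 0 x₀, c * ∫ y in (0:ℝ)..(k t), φ y ≤ φ t) (N : ℕ)
    (hxx : ∀ i ≤ N, k^[i] x ≤ x₀)
    (hdist : ∀ i ≤ N, ∀ z ∈ Icc 0 (k x),
      ∏ j ∈ Finset.range i, k' (k^[j + 1] x) ≤ D * ∏ j ∈ Finset.range i, k' (k^[j] z))
    (i : ℕ) (hi : i ≤ N) :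
    ((c / D) ^ (i + 1) / (Nat.factorial i : ℝ))
      * (∏ m ∈ Finset.range i, ∏ j ∈ Finset.range (m + 1), k' (k^[j + 1] x))
      * ∫ y in (0:ℝ)..(k x), (k x - y) ^ i * φ (k^[i] y) ≤ φ x := by
  have hD0 : 0 < D := by linarith
  have hkc : Continuous k := continuous_iff_continuousAt.2 fun y => (hk y).continuousAt
  have hkx : 0 < k x := by rw [← hk0]; exact hmono hx
  have hit0 : ∀ i, k^[i] 0 = 0 := fun i => Function.iterate_fixed hk0 i
  induction i with
  | zero =>
    have h := hφ x ⟨hx.le, hxx 0 (Nat.zero_le _)⟩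
    have h2 : 0 ≤ ∫ y in (0:ℝ)..(k x), φ y :=
      intervalIntegral.integral_nonneg hkx.le fun y _ => hφnn y
    have h3 : c / D ≤ c := div_le_self hc.le hD
    simp
    nlinarith
  | succ i ih =>
    refine le_trans ?_ (ih (by omega))
    set P := ∏ m ∈ Finset.range i, ∏ j ∈ Finset.range (m + 1), k' (k^[j + 1] x) with hP
    set w := ∏ j ∈ Finset.range (i + 1), k' (k^[j + 1] x) with hw
    have hP0 : 0 ≤ P := Finset.prod_nonneg fun m _ => Finset.prod_nonneg fun j _ => (hk'pos _).le
    have hkci : Continuous (k^[i + 1]) := hkc.iterate _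
    have hkcj : Continuous (k^[i]) := hkc.iterate _
    have hψ : Continuous (fun z => φ (k^[i + 1] z)) := hφc.comp hkci
    have key : ∀ y ∈ Icc 0 (k x),
        (c / D * w) * ∫ z in (0:ℝ)..y, φ (k^[i + 1] z) ≤ φ (k^[i] y) := by
      intro y hy
      have h1 : k^[i] y ∈ Icc 0 x₀ := by
        constructor
        · rw [← hit0 i]; exact hmono.monotone.iterate i hy.1
        · refine le_trans (hmono.monotone.iterate i hy.2) ?_
          rw [← Function.iterate_succ_apply]
          exact hxx _ hi
      refine le_trans ?_ (hφ _ h1)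
      have hcd : Continuous (fun z => ∏ j ∈ Finset.range (i + 1), k' (k^[j] z)) :=
        continuous_finsetProd _ fun j _ => hk'c.comp (hkc.iterate j)
      have hsub := intervalIntegral.integral_comp_mul_deriv (a := 0) (b := y)
        (f := k^[i + 1]) (f' := fun z => ∏ j ∈ Finset.range (i + 1), k' (k^[j] z)) (g := φ)
        (fun z _ => aux_iter_deriv k k' hk (i + 1) z) hcd.continuousOn hφc
      rw [hit0, Function.iterate_succ_apply'] at hsub
      rw [← hsub, ← intervalIntegral.integral_const_mul, ← intervalIntegral.integral_const_mul]
      apply intervalIntegral.integral_mono_on hy.1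
      · apply Continuous.intervalIntegrable; fun_prop
      · apply Continuous.intervalIntegrable
        exact continuous_const.mul (hψ.mul hcd)
      · intro z hz
        have hd := hdist (i + 1) hi z ⟨hz.1, hz.2.trans hy.2⟩
        have hd' : w / D ≤ ∏ j ∈ Finset.range (i + 1), k' (k^[j] z) := by
          rw [div_le_iff₀ hD0]; linarith
        have hφz := hφnn (k^[i + 1] z)
        calc c / D * w * φ (k^[i + 1] z) = c * (φ (k^[i + 1] z) * (w / D)) := by ring
          _ ≤ _ := by
            simp only [Function.comp]
            gcongr
    have hint : (c / D * w) * ((1 / ((i:ℝ) + 1)) *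
          ∫ y in (0:ℝ)..(k x), (k x - y) ^ (i + 1) * φ (k^[i + 1] y))
        ≤ ∫ y in (0:ℝ)..(k x), (k x - y) ^ i * φ (k^[i] y) := by
      rw [← aux_parts _ hψ, ← intervalIntegral.integral_const_mul]
      have hcv : Continuous (fun y => ∫ z in (0:ℝ)..y, φ (k^[i + 1] z)) :=
        intervalIntegral.continuous_primitive (fun a b => hψ.intervalIntegrable a b) 0
      apply intervalIntegral.integral_mono_on hkx.le
      · apply Continuous.intervalIntegrable
        fun_prop
      · apply Continuous.intervalIntegrable
        fun_prop
      · intro y hy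
        have h1 := key y hy
        have h2 : 0 ≤ (k x - y) ^ i := pow_nonneg (by linarith [hy.2]) _
        calc _ = (k x - y) ^ i * ((c / D * w) * ∫ z in (0:ℝ)..y, φ (k^[i + 1] z)) := by ring
          _ ≤ _ := by gcongr
    have hpre : 0 ≤ (c / D) ^ (i + 1) / (Nat.factorial i : ℝ) * P := by positivity
    calc _ = (c / D) ^ (i + 1) / (Nat.factorial i : ℝ) * P * ((c / D * w) * ((1 / ((i:ℝ) + 1)) *
          ∫ y in (0:ℝ)..(k x), (k x - y) ^ (i + 1) * φ (k^[i + 1] y))) := by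
            rw [Finset.prod_range_succ, ← hP, ← hw, Nat.factorial_succ]
            push_cast
            have : (Nat.factorial i : ℝ) ≠ 0 := by positivity
            rw [pow_succ (c / D) (i + 1)]
            field_simp
      _ ≤ _ := by gcongr

theorem aux_dist (k k' : ℝ → ℝ) (hk'pos : ∀ y, 0 < k' y) (hmono : StrictMono k) (hk0 : k 0 = 0)
    (M x₀ x : ℝ) (hM : 0 ≤ M) (hx : 0 < x)
    (hstep : ∀ a b, 0 ≤ a → a ≤ b → b ≤ x₀ → k' b ≤ k' a * Real.exp (M * (k b - b)))
    (N : ℕ) (hxx : ∀ i ≤ N, k^[i] x ≤ x₀) (i : ℕ) (hi : i ≤ N) (z : ℝ) (hz : z ∈ Icc 0 (k x)) :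
    ∏ j ∈ Finset.range i, k' (k^[j + 1] x)
      ≤ Real.exp (M * k (k^[i] x)) * ∏ j ∈ Finset.range i, k' (k^[j] z) := by
  have hit0 : ∀ i, k^[i] 0 = 0 := fun i => Function.iterate_fixed hk0 i
  have hkx : 0 < k x := by rw [← hk0]; exact hmono hx
  induction i with
  | zero =>
    simp
    positivity
  | succ i ih =>
    have ih := ih (by omega)
    rw [Finset.prod_range_succ, Finset.prod_range_succ]
    have h1 := hstep (k^[i] z) (k^[i + 1] x)
      (by rw [← hit0 i]; exact hmono.monotone.iterate i hz.1)
      (by rw [Function.iterate_succ_apply]; exact hmono.monotone.iterate i hz.2) (hxx _ hi)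
    have h0 : 0 ≤ ∏ j ∈ Finset.range i, k' (k^[j] z) :=
      Finset.prod_nonneg fun j _ => (hk'pos _).le
    have e : k (k^[i] x) = k^[i + 1] x := (Function.iterate_succ_apply' k i x).symm
    rw [e] at ih
    calc _ ≤ (Real.exp (M * k^[i + 1] x) * ∏ j ∈ Finset.range i, k' (k^[j] z)) *
          (k' (k^[i] z) * Real.exp (M * (k (k^[i + 1] x) - k^[i + 1] x))) := by
            have := (hk'pos (k^[i + 1] x)).le
            gcongr
      _ = _ := by
        have : M * k (k^[i + 1] x)
          = M * k^[i + 1] x + M * (k (k^[i + 1] x) - k^[i + 1] x) := by ring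
        rw [this, Real.exp_add]
        ring

theorem aux_prod (F : ℕ → ℝ) (i : ℕ) :
    ∏ m ∈ Finset.Icc 2 (i + 1), ∏ j ∈ Finset.Icc 2 m, F j
      = ∏ m ∈ Finset.range i, ∏ j ∈ Finset.range (m + 1), F (j + 2) := by
  have h : ∀ (G : ℕ → ℝ) (i : ℕ), ∏ m ∈ Finset.Icc 2 (i + 1), G m
      = ∏ m ∈ Finset.range i, G (m + 2) := by
    intro G i
    induction i with
    | zero => simp
    | succ i ih =>
      rw [Finset.prod_range_succ, ← ih, ← Finset.prod_Icc_succ_top (by omega)]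
  rw [h]
  refine Finset.prod_congr rfl fun m _ => ?_
  exact h F (m + 1)

theorem stmt_4
    (ε : ℝ) (hε : 0 < ε)
    (f g : ℝ → ℝ)
    (hf : ContDiff ℝ 2 f) (hg : ContDiff ℝ 2 g)
    (hfmono : StrictMono f)
    (hgf : Function.LeftInverse g f) (hfg : Function.RightInverse g f)
    (fm fminv : ℝ → ℝ)
    (hfm : ∀ x, fm x = f x - ε)
    (hfminv : ∀ x, fminv x = g (x + ε))
    (hfm0 : fm 0 = 0)
    (lam : ℝ) (hlam : lam = deriv fm 0) (hlam0 : 0 < lam) (hlam1 : lam < 1)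
    (p : ℝ → ℝ) (hp : ContDiffOn ℝ 1 p (Set.Icc (-ε) ε))
    (hpnn : ∀ z ∈ Set.Icc (-ε) ε, 0 ≤ p z) (hpe : 0 < p (-ε))
    (x₀' : ℝ) (hx₀' : 0 < x₀')
    (φ : ℝ → ℝ) (hφc : Continuous φ) (hφnn : ∀ x, 0 ≤ φ x)
    (hφpos : ∀ x ∈ Set.Ioc 0 x₀', 0 < φ x)
    (hstat : ∀ x ∈ Set.Icc 0 x₀',
      φ x = (1/ε) * ∫ y in (0:ℝ)..(fminv x), p (x - f y) * φ y)
    (hderivmono : MonotoneOn (deriv fm) (Set.Icc 0 x₀') ∨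
      AntitoneOn (deriv fm) (Set.Icc 0 x₀')) :
    ∃ x₀ ∈ Set.Ioo (0:ℝ) x₀',
      (∀ x ∈ Set.Ioc (0:ℝ) x₀, 0 < fm x ∧ fm x < x) ∧
      ∃ C₁ > 0, ∀ x ∈ Set.Ioo (0:ℝ) x₀, ∀ n : ℕ,
        n = sInf {k : ℕ | fm^[k] x₀ < x} →
        (C₁ ^ n / (Nat.factorial (n - 1) : ℝ))
            * (∏ m ∈ Finset.Icc 2 n, ∏ j ∈ Finset.Icc 2 m, 1 / deriv fm (fminv^[j] x))
            * ∫ y in (0:ℝ)..(fminv x), (fminv x - y) ^ (n - 1) * φ (fminv^[n - 1] y)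
          ≤ φ x := by
  have hfmfun : fm = fun x => f x - ε := funext hfm
  have hkfun : fminv = fun x => g (x + ε) := funext hfminv
  have hfmC : ContDiff ℝ 2 fm := by rw [hfmfun]; fun_prop
  have hkC : ContDiff ℝ 2 fminv := by rw [hkfun]; fun_prop
  have hL : Function.LeftInverse fminv fm := fun x => by
    rw [hfm, hfminv]; simpa using hgf x
  have hR : Function.LeftInverse fm fminv := fun x => by
    rw [hfm, hfminv, hfg]; ring
  have hfmm : StrictMono fm := fun a b hab => by
    rw [hfm, hfm]; linarith [hfmono hab]
  have hkm : StrictMono fminv := fun a b hab => by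
    by_contra hcon
    have := hfmm.monotone (not_lt.1 hcon)
    rw [hR, hR] at this
    linarith
  have hk0 : fminv 0 = 0 := by rw [← hfm0, hL, hfm0]
  have hfmd : Differentiable ℝ fm := hfmC.differentiable (by norm_num)
  have hkd : Differentiable ℝ fminv := hkC.differentiable (by norm_num)
  have hprod : ∀ y, deriv fm (fminv y) * deriv fminv y = 1 := by
    intro y
    have h1 := (hfmd (fminv y)).hasDerivAt.comp y (hkd y).hasDerivAt
    have h2 : fm ∘ fminv = id := funext hR
    rw [h2] at h1
    exact h1.unique (hasDerivAt_id y)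
  have hk'nn : ∀ y, 0 ≤ deriv fminv y := fun y => hkm.monotone.deriv_nonneg
  have hk'pos : ∀ y, 0 < deriv fminv y := fun y =>
    lt_of_le_of_ne (hk'nn y) fun h => by
      have := hprod y
      rw [← h] at this
      simp at this
  have hk'eq : ∀ y, 1 / deriv fm (fminv y) = deriv fminv y := by
    intro y
    have := hprod y
    have h0 : deriv fm (fminv y) ≠ 0 := fun h => by rw [h] at this; simp at this
    field_simp
    linarith
  have hk'C : ContDiff ℝ 1 (deriv fminv) := hkC.deriv'
  have hk'c : Continuous (deriv fminv) := hk'C.continuous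
  have hk'0 : 1 < deriv fminv 0 := by
    have h := hprod 0
    rw [hk0, ← hlam] at h
    by_contra hcon
    nlinarith [hk'pos 0]
  obtain ⟨r, hr1, hr2⟩ := exists_between hk'0
  obtain ⟨L, s, hs, hLip⟩ := hk'C.contDiffAt.exists_lipschitzOnWith (x := (0:ℝ))
  have hev1 : ∀ᶠ y in nhds (0:ℝ), r < deriv fminv y := hk'c.continuousAt.eventually (lt_mem_nhds hr2)
  have hev2 := hev1.and (show ∀ᶠ y in nhds (0:ℝ), y ∈ s from hs)
  obtain ⟨δ₁, hδ₁, hB⟩ := Metric.eventually_nhds_iff.1 hev2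
  have hpc : ContinuousWithinAt p (Icc (-ε) ε) (-ε) :=
    hp.continuousOn _ ⟨le_refl _, by linarith⟩
  have hev3 : ∀ᶠ z in nhdsWithin (-ε) (Icc (-ε) ε), p (-ε) / 2 < p z :=
    hpc.eventually (lt_mem_nhds (by linarith))
  obtain ⟨δ₂, hδ₂, hPb⟩ := Metric.mem_nhdsWithin_iff.1 hev3
  obtain ⟨x₀, hx00, hx0lt⟩ : ∃ x₀ : ℝ, 0 < x₀ ∧ x₀ < min (min δ₁ δ₂) (min x₀' ε) :=
    exists_between (by positivity)
  simp only [lt_min_iff] at hx0lt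
  obtain ⟨⟨hxd1, hxd2⟩, hxx', hxe⟩ := hx0lt
  have hder : ∀ y ∈ Icc 0 x₀, r < deriv fminv y ∧ y ∈ s := fun y hy => hB (by
    rw [Real.dist_eq, sub_zero, abs_of_nonneg hy.1]; linarith [hy.2])
  have hexp : ∀ y ∈ Icc 0 x₀, r * y ≤ fminv y := by
    intro y hy
    have := Convex.mul_sub_le_image_sub_of_le_deriv (convex_Icc (0:ℝ) x₀) hkd.continuous.continuousOn
      hkd.differentiableOn (C := r) (fun z hz => by
        rw [interior_Icc] at hz
        exact (hder z ⟨hz.1.le, hz.2.le⟩).1.le) 0 ⟨le_refl _, hx00.le⟩ y hy hy.1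
    simpa [hk0] using this
  have hfmpos : ∀ x, 0 < x → 0 < fm x := fun x hx => by rw [← hfm0]; exact hfmm hx
  have hfmlt : ∀ x ∈ Ioc (0:ℝ) x₀, fm x < x := by
    intro x hx
    have h := hexp x ⟨hx.1.le, hx.2⟩
    have h2 : x < fminv x := by nlinarith [hx.1]
    have := hfmm h2
    rwa [hR] at this
  refine ⟨x₀, ⟨hx00, hxx'⟩, fun x hx => ⟨hfmpos x hx.1, hfmlt x hx⟩, ?_⟩
  set M : ℝ := L / (r - 1) with hMdef
  have hM : 0 ≤ M := div_nonneg L.2 (by linarith)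
  set c : ℝ := (1 / ε) * (p (-ε) / 2) with hcdef
  have hc : 0 < c := by positivity
  set D : ℝ := Real.exp (M * fminv x₀) with hDdef
  have hkx0 : 0 < fminv x₀ := by rw [← hk0]; exact hkm hx00
  have hD : 1 ≤ D := Real.one_le_exp (by positivity)
  have hstep : ∀ a b, 0 ≤ a → a ≤ b → b ≤ x₀ →
      deriv fminv b ≤ deriv fminv a * Real.exp (M * (fminv b - b)) := by
    intro a b ha hab hb
    have h1 := hder a ⟨ha, hab.trans hb⟩
    have h2 := hder b ⟨ha.trans hab, hb⟩
    have h3 := hLip.dist_le_mul b h2.2 a h1.2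
    rw [Real.dist_eq, Real.dist_eq, abs_of_nonneg (sub_nonneg.2 hab)] at h3
    have h4 := (le_abs_self _).trans h3
    have h5 := hexp b ⟨ha.trans hab, hb⟩
    have h6 : (L:ℝ) * b ≤ M * (fminv b - b) := by
      have hne : r - 1 ≠ 0 := by linarith
      have : (L:ℝ) * b = M * ((r - 1) * b) := by rw [hMdef]; field_simp
      rw [this]
      apply mul_le_mul_of_nonneg_left _ hM
      linarith
    have h7 := Real.add_one_le_exp (M * (fminv b - b))
    have hLnn : (0:ℝ) ≤ L := L.2
    have h8 : (L:ℝ) * (b - a) ≤ M * (fminv b - b) := by nlinarith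
    have h9 : 0 ≤ M * (fminv b - b) := le_trans (mul_nonneg hLnn (by linarith)) h8
    calc deriv fminv b ≤ deriv fminv a + M * (fminv b - b) := by linarith
      _ ≤ deriv fminv a * (M * (fminv b - b) + 1) := by nlinarith
      _ ≤ _ := by gcongr; exact h1.1.le.trans' (by linarith)
  have hφ : ∀ t ∈ Icc 0 x₀, c * ∫ y in (0:ℝ)..(fminv t), φ y ≤ φ t := by
    intro t ht
    rw [hstat t ⟨ht.1, ht.2.trans hxx'.le⟩, hcdef, mul_assoc]
    have hkt : 0 ≤ fminv t := by rw [← hk0]; exact hkm.monotone ht.1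
    have hrange : ∀ y ∈ Icc 0 (fminv t), -ε ≤ t - f y ∧ t - f y ≤ t - ε := by
      intro y hy
      have h1 := hfmm.monotone hy.1
      have h2 := hfmm.monotone hy.2
      rw [hR, hfm] at h2
      rw [hfm0, hfm] at h1
      constructor <;> linarith
    refine mul_le_mul_of_nonneg_left ?_ (by positivity)
    rw [← intervalIntegral.integral_const_mul]
    apply intervalIntegral.integral_mono_on hkt
    · apply Continuous.intervalIntegrable; fun_prop
    · apply ContinuousOn.intervalIntegrable
      rw [uIcc_of_le hkt]
      refine ContinuousOn.mul ?_ hφc.continuousOn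
      refine hp.continuousOn.comp (by have := hf.continuous; fun_prop) ?_
      intro y hy
      have := hrange y hy
      exact ⟨this.1, by linarith [ht.2, this.2]⟩
    · intro y hy
      have h := hrange y hy
      have : p (-ε) / 2 < p (t - f y) := hPb ⟨by
        rw [Metric.mem_ball, Real.dist_eq, abs_of_nonneg (by linarith)]
        linarith [ht.2], h.1, by linarith [ht.2]⟩
      exact mul_le_mul_of_nonneg_right this.le (hφnn y)
  refine ⟨c / D, by positivity, ?_⟩
  intro x hx n hn
  -- the hitting time is a genuine minimum
  have hitpos : ∀ m, 0 < fm^[m] x₀ ∧ fm^[m] x₀ ≤ x₀ ∧ r ^ m * fm^[m] x₀ ≤ x₀ := by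
    intro m
    induction m with
    | zero => simpa using hx00
    | succ m ih =>
      rw [Function.iterate_succ_apply']
      have h1 := hfmpos _ ih.1
      have h2 := hfmlt _ ⟨ih.1, ih.2.1⟩
      have h3 := hexp (fm (fm^[m] x₀)) ⟨h1.le, by linarith [ih.2.1]⟩
      rw [hL] at h3
      refine ⟨h1, by linarith [ih.2.1], ?_⟩
      have hrm : 0 ≤ r ^ m := by positivity
      calc r ^ (m + 1) * fm (fm^[m] x₀) = r ^ m * (r * fm (fm^[m] x₀)) := by ring
        _ ≤ r ^ m * fm^[m] x₀ := by gcongr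
        _ ≤ x₀ := ih.2.2
  have hne : {k : ℕ | fm^[k] x₀ < x}.Nonempty := by
    obtain ⟨m, hm⟩ := pow_unbounded_of_one_lt (x₀ / x) hr1
    refine ⟨m, ?_⟩
    by_contra hcon
    have hcon : x ≤ fm^[m] x₀ := not_lt.1 hcon
    rw [div_lt_iff₀ hx.1] at hm
    have hrm : 0 ≤ r ^ m := by positivity
    have := mul_le_mul_of_nonneg_left hcon hrm
    linarith [(hitpos m).2.2]
  have hmem : fm^[n] x₀ < x := by rw [hn]; exact Nat.sInf_mem hne
  obtain ⟨N, rfl⟩ : ∃ N, n = N + 1 := Nat.exists_eq_succ_of_ne_zero (by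
    rintro rfl
    simp at hmem
    linarith [hx.2])
  have hxx : ∀ i ≤ N, fminv^[i] x ≤ x₀ := by
    intro i hi
    have hnot : ¬ fm^[i] x₀ < x := Nat.notMem_of_lt_sInf (s := {k : ℕ | fm^[k] x₀ < x})
      (by rw [← hn]; omega)
    have := hkm.monotone.iterate i (not_lt.1 hnot)
    rwa [hL.iterate i] at this
  have hdist : ∀ i ≤ N, ∀ z ∈ Icc 0 (fminv x),
      ∏ j ∈ Finset.range i, deriv fminv (fminv^[j + 1] x)
        ≤ D * ∏ j ∈ Finset.range i, deriv fminv (fminv^[j] z) := by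
    intro i hi z hz
    refine (aux_dist fminv (deriv fminv) hk'pos hkm hk0 M x₀ x hM hx.1 hstep N hxx i hi z hz).trans ?_
    apply mul_le_mul_of_nonneg_right _ (Finset.prod_nonneg fun j _ => (hk'pos _).le)
    apply Real.exp_le_exp.2
    exact mul_le_mul_of_nonneg_left (hkm.monotone (hxx i hi)) hM
  have hfinal := aux_core fminv (deriv fminv) φ (fun y => (hkd y).hasDerivAt) hk'c hk'pos hkm hk0
    hφc hφnn c D x₀ x hc hD hx.1 hφ N hxx hdist N le_rfl
  have hP : ∏ m ∈ Finset.Icc 2 (N + 1), ∏ j ∈ Finset.Icc 2 m, 1 / deriv fm (fminv^[j] x)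
      = ∏ m ∈ Finset.range N, ∏ j ∈ Finset.range (m + 1), deriv fminv (fminv^[j + 1] x) := by
    rw [aux_prod (fun j => 1 / deriv fm (fminv^[j] x))]
    refine Finset.prod_congr rfl fun m _ => Finset.prod_congr rfl fun j _ => ?_
    rw [← hk'eq, ← Function.iterate_succ_apply' fminv (j + 1) x]
  rw [hP]
  simpa using hfinal
end

section
/- The double sum of logarithmic derivatives along backward orbits satisfies ∑_{m=2}^{n(x)} ∑_{j=2}^{m} log f₋'(f₋^{−j}(x)) = (n(x)(n(x)−1)/2) · log λ + O(log x) as x → 0⁺: there exist C > 0 and δ ∈ (0, x₀) such that for all x ∈ (0, δ), |∑_{m=2}^{n(x)} ∑_{j=2}^{m} log f₋'(f₋^{−j}(x)) − (n(x)(n(x)−1)/2) · log λ| ≤ C |log x|, where f₋^{−j} denotes the j-th iterate of the inverse map f₋⁻¹. -/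
open MeasureTheory Filter Set

lemma aux_geom (r : ℝ) (h0 : 0 < r) (h1 : r < 1) (n m : ℕ) (hm : m ≤ n) :
    ∑ j ∈ Finset.Icc 2 m, r ^ (n - j) ≤ r ^ (n - m) / (1 - r) := by
  have h1' : 0 < 1 - r := by linarith
  induction m with
  | zero => simp; positivity
  | succ m ih =>
    rcases Nat.eq_zero_or_pos m with rfl | hp
    · simp; positivity
    · rw [Finset.sum_Icc_succ_top (by omega)]
      have := ih (by omega)
      have e : n - m = (n - (m + 1)) + 1 := by omega
      rw [e, pow_succ] at this
      have e2 : r ^ (n - (m+1)) / (1 - r) = r ^ (n - (m+1)) * r / (1 - r) + r ^ (n - (m+1)) := by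
        field_simp
        ring
      linarith

lemma aux_const (L : ℝ) (n : ℕ) :
    ∑ m ∈ Finset.Icc 2 n, ∑ _j ∈ Finset.Icc 2 m, L = ((n : ℝ) * ((n : ℝ) - 1) / 2) * L := by
  induction n with
  | zero => simp
  | succ m ih =>
    rcases Nat.eq_zero_or_pos m with rfl | hp
    · simp
    · rw [Finset.sum_Icc_succ_top (by omega), ih]
      simp only [Finset.sum_const, Nat.card_Icc, nsmul_eq_mul]
      have : m + 1 + 1 - 2 = m := by omega
      rw [this]
      push_cast
      ring

lemma aux_dslope {h : ℝ → ℝ} (hd : Differentiable ℝ h) : Continuous (dslope h 0) := by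
  rw [continuous_iff_continuousAt]
  intro y
  by_cases hy : y = 0
  · subst hy
    exact continuousAt_dslope_same.2 (hd 0)
  · exact (continuousAt_dslope_of_ne hy).2 (hd y).continuousAt

theorem stmt_13
    (ε : ℝ) (hε : 0 < ε)
    (lam : ℝ) (hlam0 : 0 < lam) (hlam1 : lam < 1)
    (fm : ℝ → ℝ) (hfm : ContDiff ℝ 2 fm) (hfmmono : StrictMono fm)
    (hfm0 : fm 0 = 0) (hfmderiv : deriv fm 0 = lam)
    (x₀ : ℝ) (hx₀ : 0 < x₀)
    (hcontr : ∀ x ∈ Set.Ioc (0:ℝ) x₀, 0 < fm x ∧ fm x < x)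
    (fminv : ℝ → ℝ) (hfminvC : ContDiff ℝ 2 fminv)
    (hli : Function.LeftInverse fminv fm) (hri : Function.RightInverse fminv fm) :
    ∃ C > 0, ∃ δ ∈ Set.Ioo (0:ℝ) x₀, ∀ x ∈ Set.Ioo (0:ℝ) δ, ∀ n : ℕ,
      n = sInf {k : ℕ | fm^[k] x₀ < x} →
      |(∑ m ∈ Finset.Icc 2 n, ∑ j ∈ Finset.Icc 2 m, Real.log (deriv fm (fminv^[j] x)))
          - ((n : ℝ) * ((n : ℝ) - 1) / 2) * Real.log lam|
        ≤ C * |Real.log x| := by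
  have hdf : Differentiable ℝ fm := hfm.differentiable (by norm_num)
  have hdi : Differentiable ℝ fminv := hfminvC.differentiable (by norm_num)
  have hinvmono : StrictMono fminv := by
    intro a b hab
    rw [← hfmmono.lt_iff_lt, hri a, hri b]; exact hab
  have hinv0 : fminv 0 = 0 := by have := hli 0; rwa [hfm0] at this
  have hne : ∀ y, deriv fm y ≠ 0 := by
    intro y hy
    have h1 : HasDerivAt (fminv ∘ fm) (deriv fminv (fm y) * deriv fm y) y :=
      (hdi (fm y)).hasDerivAt.comp y (hdf y).hasDerivAt
    rw [hli.comp_eq_id] at h1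
    have := h1.unique (hasDerivAt_id y)
    rw [hy] at this
    simp at this
  have hdd : Differentiable ℝ (deriv fm) := by
    have : ContDiff ℝ 1 (deriv fm) := by
      have h2 : ContDiff ℝ (1 + 1) fm := by simpa [one_add_one_eq_two] using hfm
      exact (contDiff_succ_iff_deriv.1 h2).2.2
    exact this.differentiable (by norm_num)
  have hh : Differentiable ℝ (fun y => Real.log (deriv fm y)) := fun y =>
    (hdd y).log (hne y)
  set x₁ := fminv x₀ with hx₁
  have hfx₁ : fm x₁ = x₀ := hri x₀
  have h01 : x₀ < x₁ := by
    rw [← hfmmono.lt_iff_lt, hfx₁]; exact (hcontr x₀ ⟨hx₀, le_rfl⟩).2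
  have hx₁0 : 0 < x₁ := hx₀.trans h01
  have hcon : ∀ y, 0 < y → y ≤ x₁ → fm y < y := by
    intro y h0 h1
    rcases le_or_gt y x₀ with h | h
    · exact (hcontr y ⟨h0, h⟩).2
    · have := hfmmono.monotone h1
      linarith
  obtain ⟨z, hz, hzmax⟩ := (isCompact_Icc (a := (0:ℝ)) (b := x₁)).exists_isMaxOn
    ⟨0, le_rfl, hx₁0.le⟩ (aux_dslope hdf).continuousOn
  have hds : ∀ (h : ℝ → ℝ) (y : ℝ), 0 < y → h y - h 0 = dslope h 0 y * y := by
    intro h y hy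
    rw [dslope_of_ne _ hy.ne', slope_def_field, sub_zero, div_mul_cancel₀ _ hy.ne']
  set r := dslope fm 0 z with hr
  have hr0 : 0 < r := by
    have := hzmax (show (0:ℝ) ∈ Icc 0 x₁ from ⟨le_rfl, hx₁0.le⟩)
    simp only [mem_ofPred_eq, dslope_same, hfmderiv] at this
    linarith
  have hr1 : r < 1 := by
    rcases hz.1.eq_or_lt with h | h
    · rw [hr, ← h, dslope_same, hfmderiv]; exact hlam1
    · have a := hds fm z h
      have b := hcon z h hz.2
      rw [hfm0, ← hr] at a
      by_contra hc
      push Not at hc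
      nlinarith
  have hrc : ∀ y, 0 < y → y ≤ x₁ → fm y ≤ r * y := by
    intro y h0 h1
    have a := hds fm y h0
    have b : dslope fm 0 y ≤ r := hzmax (show y ∈ Icc 0 x₁ from ⟨h0.le, h1⟩)
    rw [hfm0] at a
    nlinarith
  obtain ⟨K, hK⟩ := (isCompact_Icc (a := (0:ℝ)) (b := x₁)).exists_bound_of_continuousOn
    (aux_dslope hh).continuousOn
  have hK0 : 0 ≤ K := (norm_nonneg _).trans (hK 0 ⟨le_rfl, hx₁0.le⟩)
  have hr1' : 0 < 1 - r := by linarith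
  refine ⟨K * x₁ / (1 - r) / (1 - r) + 1, by positivity, min (x₀ / 2) (Real.exp (-1)),
    ⟨by positivity, (min_le_left _ _).trans_lt (by linarith)⟩, ?_⟩
  intro x hx n hn
  have hx0 := hx.1
  have hxx : x < x₀ := by have := hx.2.trans_le (min_le_left _ _); linarith
  have hlog : 1 ≤ |Real.log x| := by
    have := Real.log_lt_log hx0 (hx.2.trans_le (min_le_right _ _))
    rw [Real.log_exp] at this
    rw [abs_of_neg (by linarith)]; linarith
  have hpos : ∀ j, 0 < fminv^[j] x := by
    intro j
    induction j with
    | zero => simpa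
    | succ k ih =>
      rw [Function.iterate_succ_apply', ← hinv0]; exact hinvmono ih
  have hle0 : ∀ k, k < n → fminv^[k] x ≤ x₀ := by
    intro k hk
    rw [hn] at hk
    have := Nat.notMem_of_lt_sInf hk
    simp only [mem_ofPred_eq, not_lt] at this
    have := (hinvmono.monotone.iterate k) this
    rwa [(hli.iterate k) x₀] at this
  have hle1 : ∀ k, k ≤ n → fminv^[k] x ≤ x₁ := by
    intro k hk
    cases k with
    | zero => simp; linarith
    | succ k =>
      rw [Function.iterate_succ_apply']
      exact hinvmono.monotone (hle0 k (by omega))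
  have hgeo : ∀ i, i ≤ n → fminv^[n - i] x ≤ r ^ i * x₁ := by
    intro i
    induction i with
    | zero => intro _; simpa using hle1 n le_rfl
    | succ i ih =>
      intro hi
      have a := ih (by omega)
      have e : n - i = (n - (i+1)) + 1 := by omega
      have b : fminv^[n - (i+1)] x = fm (fminv^[n - i] x) := by
        rw [e, Function.iterate_succ_apply', hri]
      rw [b]
      have c := hrc _ (hpos (n - i)) (hle1 _ (by omega))
      rw [pow_succ]
      nlinarith
  have hterm : ∀ j, j ≤ n → |Real.log (deriv fm (fminv^[j] x)) - Real.log lam|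
      ≤ K * x₁ * r ^ (n - j) := by
    intro j hj
    have a := hds (fun y => Real.log (deriv fm y)) _ (hpos j)
    simp only [hfmderiv] at a
    rw [a, abs_mul, abs_of_pos (hpos j)]
    have b := hK _ ⟨(hpos j).le, hle1 j hj⟩
    rw [Real.norm_eq_abs] at b
    have c := hgeo (n - j) (by omega)
    rw [Nat.sub_sub_self hj] at c
    calc _ ≤ K * (r ^ (n - j) * x₁) := mul_le_mul b c (hpos j).le hK0
      _ = _ := by ring
  rw [← aux_const, ← Finset.sum_sub_distrib]
  simp only [← Finset.sum_sub_distrib]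
  have hKx : 0 ≤ K * x₁ := by positivity
  have main : |∑ m ∈ Finset.Icc 2 n, ∑ j ∈ Finset.Icc 2 m,
      (Real.log (deriv fm (fminv^[j] x)) - Real.log lam)| ≤ K * x₁ / (1 - r) / (1 - r) := by
    calc _ ≤ ∑ m ∈ Finset.Icc 2 n, K * x₁ / (1 - r) * r ^ (n - m) := by
          refine (Finset.abs_sum_le_sum_abs _ _).trans (Finset.sum_le_sum fun m hm => ?_)
          have hm := (Finset.mem_Icc.1 hm).2
          calc _ ≤ ∑ j ∈ Finset.Icc 2 m, K * x₁ * r ^ (n - j) := by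
                refine (Finset.abs_sum_le_sum_abs _ _).trans (Finset.sum_le_sum fun j hj => ?_)
                exact hterm j ((Finset.mem_Icc.1 hj).2.trans hm)
            _ ≤ K * x₁ * (r ^ (n - m) / (1 - r)) := by
                rw [← Finset.mul_sum]
                exact mul_le_mul_of_nonneg_left (aux_geom r hr0 hr1 n m hm) hKx
            _ = _ := by ring
      _ ≤ K * x₁ / (1 - r) * (r ^ (n - n) / (1 - r)) := by
          rw [← Finset.mul_sum]
          exact mul_le_mul_of_nonneg_left (aux_geom r hr0 hr1 n n le_rfl) (by positivity)
      _ = _ := by simp; ring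
  have hC : 0 ≤ K * x₁ / (1 - r) / (1 - r) := by positivity
  nlinarith
end

section
/- As x → 0⁺, the stationary density satisfies the one-sided upper bound log φ(x) ≤ (1/(2 log λ)) (log x)² − (1/log λ) (log x)·log log(1/x) + O(log x): there exist C > 0 and δ ∈ (0, x₀') such that for all x ∈ (0, δ), log φ(x) ≤ (1/(2 log λ)) (log x)² − (1/log λ) (log x)·log log(1/x) + C |log x|. -/
open MeasureTheory Filter Set

lemma aux_iter (φ h : ℝ → ℝ) (c K R R1 S B : ℝ) (hc : 1 < c) (hK : 0 ≤ K) (hR1 : 0 < R1)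
    (hRR : R1 ≤ R) (hS : 1 ≤ S) (hB : 0 ≤ B) (hφc : Continuous φ) (hφnn : ∀ x, 0 ≤ φ x)
    (hφS : ∀ x ∈ Icc 0 R, φ x ≤ S)
    (hh0 : ∀ x ∈ Icc 0 R1, 0 ≤ h x) (hhR : ∀ x ∈ Icc 0 R1, h x ≤ R)
    (hhK : ∀ x ∈ Icc 0 R1, h x ≤ c * x * (1 + K * x))
    (hint : ∀ x ∈ Icc 0 R1, φ x ≤ B * ∫ y in (0:ℝ)..(h x), φ y) :
    ∃ M : ℝ, 1 ≤ M ∧ ∀ n : ℕ, ∀ x ∈ Icc 0 R,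
      φ x ≤ S * (M ^ n * c ^ (∑ i ∈ Finset.range (n+1), i) / (n.factorial : ℝ)) * x ^ n := by
  obtain ⟨a, ha⟩ : ∃ a, a = K / (c - 1) := ⟨_, rfl⟩
  have hc1 : 0 < c - 1 := by linarith
  have ha0 : 0 ≤ a := by rw [ha]; positivity
  have haK : K = a * (c - 1) := by rw [ha]; field_simp
  have hR0 : 0 < R := by linarith
  obtain ⟨ψ, hψ⟩ : ∃ ψ : ℝ → ℝ, ψ = fun x => x / (1 + a * x) := ⟨_, rfl⟩
  have hψ0 : ∀ x, 0 ≤ x → 0 ≤ ψ x := by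
    intro x hx; rw [hψ]; positivity
  have hψx : ∀ x, 0 ≤ x → ψ x ≤ x := by
    intro x hx; rw [hψ]
    apply div_le_self hx
    have := mul_nonneg ha0 hx
    linarith
  have hψm : ∀ x y, 0 ≤ x → x ≤ y → ψ x ≤ ψ y := by
    intro x y hx hxy
    rw [hψ]
    have hy : 0 ≤ y := by linarith
    simp only
    rw [div_le_div_iff₀ (by positivity) (by positivity)]
    nlinarith
  have hψh : ∀ x ∈ Icc 0 R1, ψ (h x) ≤ c * ψ x := by
    intro x hx
    have hx0 := hx.1
    refine (hψm _ _ (hh0 x hx) (hhK x hx)).trans ?_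
    rw [hψ]
    simp only
    have hcp : 0 < c := by linarith
    rw [← mul_div_assoc, div_le_div_iff₀ (by positivity) (by positivity)]
    have h1 : (1 + K * x) * (1 + a * x) ≤ 1 + a * (c * x * (1 + K * x)) := by
      have : 1 + a * (c * x * (1 + K * x)) - (1 + K * x) * (1 + a * x)
        = K * x * (K * x) := by
          rw [haK]; ring
      nlinarith [mul_self_nonneg (K * x)]
    have := mul_le_mul_of_nonneg_left h1 (show 0 ≤ c * x by positivity)
    nlinarith
  have hψd : ∀ x, 0 ≤ x → HasDerivAt ψ (1 / (1 + a * x)^2) x := by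
    intro x hx
    rw [hψ]
    have hne : 1 + a * x ≠ 0 := by positivity
    have h1 : HasDerivAt (fun x : ℝ => 1 + a * x) a x := by
      simpa using ((hasDerivAt_id x).const_mul a).const_add 1
    refine ((hasDerivAt_id x).div h1 hne).congr_deriv ?_
    simp
    ring
  have hψR1 : 0 < ψ R1 := by rw [hψ]; positivity
  set D := (1 + a * R)^2 with hD
  have hD0 : 0 < D := by positivity
  obtain ⟨M, hM1, hMB, hMR⟩ : ∃ M : ℝ, 1 ≤ M ∧ B * D ≤ M ∧ 1 / ((c-1) * ψ R1) ≤ M :=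
    ⟨max 1 (max (B*D) (1 / ((c-1) * ψ R1))), le_max_left _ _,
      (le_max_left _ _).trans (le_max_right _ _), (le_max_right _ _).trans (le_max_right _ _)⟩
  refine ⟨M, hM1, ?_⟩
  have key : ∀ n : ℕ, S ≤ S * (M ^ n * c ^ (∑ i ∈ Finset.range (n+1), i) / (n.factorial : ℝ)) * (ψ R1) ^ n ∧ ∀ x ∈ Icc 0 R,
      φ x ≤ S * (M ^ n * c ^ (∑ i ∈ Finset.range (n+1), i) / (n.factorial : ℝ)) * (ψ x) ^ n := by
    intro n
    induction n with
    | zero => simpa using hφS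
    | succ n ih =>
      obtain ⟨ih1, ih2⟩ := ih
      set A := S * (M ^ n * c ^ (∑ i ∈ Finset.range (n+1), i) / (n.factorial : ℝ)) with hA
      have hcp : 0 < c := by linarith
      have hMp : 0 < M := by linarith
      have hSp : 0 < S := by linarith
      have hAp : 0 < A := by rw [hA]; positivity
      have hA' : S * (M ^ (n+1) * c ^ (∑ i ∈ Finset.range (n+1+1), i) / ((n+1).factorial : ℝ))
          = A * (M * c ^ (n+1) / (n+1)) := by
        rw [hA, Finset.sum_range_succ _ (n+1), Nat.factorial_succ]
        push_cast
        field_simp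
        ring
      rw [hA']
      have hbig : S ≤ A * (M * c ^ (n + 1) / (↑n + 1)) * ψ R1 ^ (n + 1) := by
        have hb : 1 + ((n+1 : ℕ):ℝ) * (c - 1) ≤ (1 + (c-1)) ^ (n+1) :=
          one_add_mul_le_pow (by linarith) _
        push_cast at hb
        have hb2 : ((n:ℝ)+1) * (c-1) ≤ c ^ (n+1) := by
          have : 1 + (c-1) = c := by ring
          rw [this] at hb; linarith
        have h1 : 1 ≤ (M * c ^ (n + 1) / (↑n + 1)) * ψ R1 := by
          rw [div_le_iff₀ (by positivity)] at hMR
          rw [div_mul_eq_mul_div, le_div_iff₀ (by positivity)]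
          have := mul_le_mul_of_nonneg_left hb2 (show 0 ≤ M * ψ R1 by positivity)
          have hn : (0:ℝ) ≤ n := Nat.cast_nonneg n
          nlinarith
        calc S ≤ A * ψ R1 ^ n := ih1
          _ ≤ (A * ψ R1 ^ n) * ((M * c ^ (n + 1) / (↑n + 1)) * ψ R1) :=
            le_mul_of_one_le_right (by positivity) h1
          _ = _ := by ring
      refine ⟨hbig, ?_⟩
      intro x hx
      rcases le_total x R1 with hxR | hxR
      · have hx1 : x ∈ Icc 0 R1 := ⟨hx.1, hxR⟩
        have hh := hh0 x hx1
        have hFTC : ∫ y in (0:ℝ)..(h x), (ψ y)^n * (1 / (1 + a * y)^2) = ψ (h x) ^ (n+1) / (n+1) := by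
          rw [intervalIntegral.integral_eq_sub_of_hasDerivAt (f := fun y => ψ y ^ (n+1) / (n+1))]
          · have : ψ 0 = 0 := by rw [hψ]; simp
            simp [this]
          · intro y hy
            rw [uIcc_of_le hh] at hy
            refine (((hψd y hy.1).pow (n+1)).div_const ((n:ℝ)+1)).congr_deriv ?_
            push_cast
            field_simp
          · apply ContinuousOn.intervalIntegrable
            rw [uIcc_of_le hh]
            apply ContinuousOn.mul
            · apply ContinuousOn.pow
              intro y hy
              exact (hψd y hy.1).continuousAt.continuousWithinAt
            · apply ContinuousOn.div continuousOn_const (by fun_prop)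
              intro y hy
              have := hy.1
              positivity
        have hle : ∫ y in (0:ℝ)..(h x), φ y ≤ ∫ y in (0:ℝ)..(h x), (A * D) * ((ψ y)^n * (1 / (1 + a * y)^2)) := by
          apply intervalIntegral.integral_mono_on hh (hφc.intervalIntegrable _ _)
          · apply ContinuousOn.intervalIntegrable
            rw [uIcc_of_le hh]
            apply ContinuousOn.mul continuousOn_const
            apply ContinuousOn.mul
            · apply ContinuousOn.pow
              intro y hy
              exact (hψd y hy.1).continuousAt.continuousWithinAt
            · apply ContinuousOn.div continuousOn_const (by fun_prop)
              intro y hy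
              have := hy.1
              positivity
          · intro y hy
            have hyR : y ≤ R := hy.2.trans (hhR x hx1)
            have hy0 := hy.1
            refine (ih2 y ⟨hy.1, hyR⟩).trans ?_
            have h1 : 1 ≤ D * (1 / (1 + a * y)^2) := by
              rw [mul_one_div, le_div_iff₀ (by positivity), one_mul, hD]
              gcongr
            have h2 : 0 ≤ A * ψ y ^ n := mul_nonneg hAp.le (pow_nonneg (hψ0 y hy0) n)
            calc _ ≤ (A * ψ y ^ n) * (D * (1 / (1 + a * y)^2)) := le_mul_of_one_le_right h2 h1
              _ = _ := by ring
        rw [intervalIntegral.integral_const_mul, hFTC] at hle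
        have hpsi : ψ (h x) ^ (n+1) ≤ (c * ψ x) ^ (n+1) :=
          pow_le_pow_left₀ (hψ0 _ hh) (hψh x hx1) _
        have hψx0 := hψ0 x hx.1
        calc φ x ≤ B * ∫ y in (0:ℝ)..(h x), φ y := hint x hx1
          _ ≤ B * (A * D * (ψ (h x) ^ (n+1) / (n+1))) := by gcongr
          _ ≤ B * (A * D * ((c * ψ x) ^ (n+1) / (n+1))) := by gcongr
          _ = (B * D) * (A * ((c * ψ x) ^ (n+1) / (n+1))) := by ring
          _ ≤ M * (A * ((c * ψ x) ^ (n+1) / (n+1))) := by gcongr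
          _ = _ := by rw [mul_pow]; ring
      · refine (hφS x hx).trans (hbig.trans ?_)
        have := hψm R1 x hR1.le hxR
        gcongr
  intro n x hx
  refine ((key n).2 x hx).trans ?_
  have := hψ0 x hx.1
  have := hψx x hx.1
  have : 0 < c := by linarith
  gcongr

lemma aux_asymp (lam S M : ℝ) (h0 : 0 < lam) (h1 : lam < 1) (hS : 1 ≤ S) (hM : 1 ≤ M) :
    ∃ C > 0, ∃ d > 0, ∀ x ∈ Ioo (0:ℝ) d, ∀ v : ℝ, 0 < v →
      (∀ n : ℕ, v ≤ S * (M ^ n * (1/lam) ^ (∑ i ∈ Finset.range (n+1), i) / (n.factorial : ℝ)) * x ^ n) →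
      Real.log v ≤ (1 / (2 * Real.log lam)) * (Real.log x) ^ 2
        - (1 / Real.log lam) * Real.log x * Real.log (Real.log (1/x)) + C * |Real.log x| := by
  obtain ⟨Q, hQ⟩ : ∃ Q, Q = - Real.log lam := ⟨_, rfl⟩
  have hQ0 : 0 < Q := by rw [hQ]; linarith [Real.log_neg h0 h1]
  have hll : Real.log lam = -Q := by linarith
  have hlS : 0 ≤ Real.log S := Real.log_nonneg hS
  have hlM : 0 ≤ Real.log M := Real.log_nonneg hM
  refine ⟨Real.log S + Real.log M / Q + Q/2 + 1/2 + 1/Q + 1 + |Real.log (2*Q)|/Q, by positivity,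
    Real.exp (-(1+2*Q)), Real.exp_pos _, ?_⟩
  intro x hx v hv hn
  have hx0 := hx.1
  obtain ⟨L, hL⟩ : ∃ L, L = - Real.log x := ⟨_, rfl⟩
  have hlx : Real.log x = -L := by linarith
  have hLb : 1 + 2 * Q < L := by
    have := (Real.log_lt_iff_lt_exp hx0).2 hx.2
    linarith
  have hL0 : 0 < L := by linarith
  have hl1x : Real.log (1/x) = L := by rw [one_div, Real.log_inv]; linarith
  rw [hl1x, hlx, hll, abs_neg, abs_of_pos hL0]
  obtain ⟨t, ht⟩ : ∃ t, t = L / Q := ⟨_, rfl⟩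
  have htQ : L = Q * t := by rw [ht]; field_simp
  have ht2 : 2 ≤ t := by rw [ht, le_div_iff₀ hQ0]; linarith
  obtain ⟨n, hnn⟩ : ∃ n, n = ⌊t⌋₊ := ⟨_, rfl⟩
  have hnt : (n:ℝ) ≤ t := by rw [hnn]; exact Nat.floor_le (by linarith)
  have hnt1 : t < n + 1 := by rw [hnn]; exact Nat.lt_floor_add_one t
  have hn0 : (0:ℝ) < n := by linarith
  have hlog := Real.log_le_log hv (hn n)
  have hMp : 0 < M := by linarith
  have hSp : 0 < S := by linarith
  have hfac : (0:ℝ) < n.factorial := by exact_mod_cast Nat.factorial_pos n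
  have hc0 : 0 < 1 / lam := by positivity
  rw [Real.log_mul (by positivity) (by positivity), Real.log_mul (by positivity) (by positivity),
    Real.log_div (by positivity) (by positivity), Real.log_mul (by positivity) (by positivity),
    Real.log_pow, Real.log_pow, Real.log_pow, hlx, one_div, Real.log_inv, hll] at hlog
  have hsum : ((∑ i ∈ Finset.range (n+1), i : ℕ):ℝ) = n * (n+1) / 2 := by
    have := Finset.sum_range_id_mul_two (n+1)
    have h2 : ((∑ i ∈ Finset.range (n+1), i : ℕ):ℝ) * 2 = (n+1) * n := by exact_mod_cast this
    linarith
  rw [hsum] at hlog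
  have hfl : n * Real.log n - n ≤ Real.log n.factorial := by
    have := Real.pow_div_factorial_le_exp (n:ℝ) hn0.le n
    have h3 := Real.log_le_log (by positivity) this
    rw [Real.log_exp, Real.log_div (by positivity) (by positivity), Real.log_pow] at h3
    linarith
  have hlogn : Real.log L - Real.log (2*Q) ≤ Real.log n := by
    rw [← Real.log_div (by positivity) (by positivity)]
    apply Real.log_le_log (by positivity)
    rw [div_le_iff₀ (by positivity), htQ]
    nlinarith
  have hlL0 : 0 ≤ Real.log L := Real.log_nonneg (by linarith)
  have hlL1 : Real.log L ≤ L := by linarith [Real.log_le_sub_one_of_pos hL0]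
  have hnl : t * Real.log L - L - t * |Real.log (2*Q)| ≤ n * Real.log n := by
    have e1 := mul_le_mul_of_nonneg_left hlogn hn0.le
    have e2 : (n:ℝ) * Real.log (2*Q) ≤ t * |Real.log (2*Q)| :=
      (mul_le_mul_of_nonneg_left (le_abs_self _) hn0.le).trans
        (mul_le_mul_of_nonneg_right hnt (abs_nonneg _))
    nlinarith
  have hq : Q * (n * (n+1)/2) - n * L ≤ Q / 2 - L * t / 2 + L / 2 := by
    rw [htQ]
    have hs : (t - n)^2 ≤ 1 := by nlinarith
    nlinarith
  have hMn : n * Real.log M ≤ t * Real.log M := mul_le_mul_of_nonneg_right hnt hlM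
  have e0 : Real.log S ≤ Real.log S * L := le_mul_of_one_le_right hlS (by linarith)
  have eQ : Q / 2 ≤ Q / 2 * L := le_mul_of_one_le_right (by positivity) (by linarith)
  have goal_eq : 1 / (2 * -Q) * (-L) ^ 2 - 1 / -Q * -L * Real.log L +
      (Real.log S + Real.log M / Q + Q / 2 + 1 / 2 + 1 / Q + 1 + |Real.log (2 * Q)| / Q) * L
      = - (L * t / 2) - t * Real.log L + (Real.log S * L + t * Real.log M + Q/2*L + L/2 + t + L
        + t * |Real.log (2*Q)|) := by
    rw [ht]; field_simp
  rw [goal_eq]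
  linarith

theorem stmt_15
    (ε : ℝ) (hε : 0 < ε)
    (f g : ℝ → ℝ)
    (hf : ContDiff ℝ 2 f) (hg : ContDiff ℝ 2 g)
    (hfmono : StrictMono f)
    (hgf : Function.LeftInverse g f) (hfg : Function.RightInverse g f)
    (fm fminv : ℝ → ℝ)
    (hfm : ∀ x, fm x = f x - ε)
    (hfminv : ∀ x, fminv x = g (x + ε))
    (hfm0 : fm 0 = 0)
    (lam : ℝ) (hlam : lam = deriv fm 0) (hlam0 : 0 < lam) (hlam1 : lam < 1)
    (p : ℝ → ℝ) (hp : ContDiffOn ℝ 1 p (Set.Icc (-ε) ε))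
    (hpnn : ∀ z ∈ Set.Icc (-ε) ε, 0 ≤ p z) (hpe : 0 < p (-ε))
    (x₀' : ℝ) (hx₀' : 0 < x₀')
    (φ : ℝ → ℝ) (hφc : Continuous φ) (hφnn : ∀ x, 0 ≤ φ x)
    (hφpos : ∀ x ∈ Set.Ioc 0 x₀', 0 < φ x)
    (hstat : ∀ x ∈ Set.Icc 0 x₀',
      φ x = (1/ε) * ∫ y in (0:ℝ)..(fminv x), p (x - f y) * φ y)
    (hderivmono : MonotoneOn (deriv fm) (Set.Icc 0 x₀') ∨
      AntitoneOn (deriv fm) (Set.Icc 0 x₀')) :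
    ∃ C > 0, ∃ δ ∈ Set.Ioo (0:ℝ) x₀', ∀ x ∈ Set.Ioo (0:ℝ) δ,
      Real.log (φ x) ≤ (1 / (2 * Real.log lam)) * (Real.log x) ^ 2
        - (1 / Real.log lam) * Real.log x * Real.log (Real.log (1/x)) + C * |Real.log x| := by
  have hfd : Differentiable ℝ f := hf.differentiable (by norm_num)
  have hgd : Differentiable ℝ g := hg.differentiable (by norm_num)
  have hf0 : f 0 = ε := by have := hfm 0; linarith
  have hgε : g ε = 0 := by rw [← hf0]; exact hgf 0
  have hgmono : Monotone g := by
    intro x y hxy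
    rw [← hfmono.le_iff_le, hfg x, hfg y]; exact hxy
  have hlamf : lam = deriv f 0 := by
    rw [hlam, show fm = fun x => f x - ε from funext hfm, deriv_sub_const]
  have hgder : deriv g ε = 1 / lam := by
    have h1 : HasDerivAt (g ∘ f) (deriv g (f 0) * deriv f 0) 0 :=
      (hgd (f 0)).hasDerivAt.comp 0 (hfd 0).hasDerivAt
    rw [show g ∘ f = id from funext hgf] at h1
    have h2 := h1.unique (hasDerivAt_id 0)
    rw [hf0, ← hlamf] at h2
    field_simp
    exact h2
  obtain ⟨C0, hC0⟩ := exists_taylor_mean_remainder_bound (f := g) (a := ε) (b := ε + 1) (n := 1)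
    (by linarith) (by exact_mod_cast hg.contDiffOn)
  obtain ⟨K, hK⟩ : ∃ K, K = lam * |C0| := ⟨_, rfl⟩
  have hK0 : 0 ≤ K := by rw [hK]; positivity
  have hc : 1 < 1 / lam := by rw [lt_div_iff₀ hlam0]; linarith
  have hgK : ∀ x ∈ Icc (0:ℝ) 1, fminv x ≤ (1/lam) * x * (1 + K * x) := by
    intro x hx
    have h1 := hC0 (x + ε) ⟨by linarith [hx.1], by linarith [hx.2]⟩
    have hdw : derivWithin g (Icc ε (ε+1)) ε = 1 / lam := by
      rw [← hgder]
      exact (hgd ε).derivWithin (uniqueDiffOn_Icc (by linarith) ε ⟨le_refl _, by linarith⟩)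
    rw [taylorWithinEval_succ, taylor_within_zero_eval, hgε, iteratedDerivWithin_one, hdw] at h1
    simp at h1
    have h2 := (le_abs_self _).trans h1
    have h3 : C0 * x ^ 2 ≤ |C0| * x ^ 2 := mul_le_mul_of_nonneg_right (le_abs_self _) (sq_nonneg _)
    rw [hfminv, hK]
    have : 1 / lam * x * (1 + lam * |C0| * x) = x * lam⁻¹ + |C0| * x^2 := by field_simp
    rw [this]
    linarith
  obtain ⟨P, hP⟩ := isCompact_Icc.exists_bound_of_continuousOn hp.continuousOn
  have hP0 : 0 ≤ P := (norm_nonneg _).trans (hP (-ε) ⟨le_refl _, by linarith⟩)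
  obtain ⟨R, hR⟩ : ∃ R, R = 1/lam * (1 + K) := ⟨_, rfl⟩
  have hR1 : 1 ≤ R := by rw [hR]; nlinarith
  obtain ⟨S0, hS0⟩ := (isCompact_Icc (a := (0:ℝ)) (b := R)).exists_bound_of_continuousOn hφc.continuousOn
  obtain ⟨r, hr0, hrx, hrε, hr1⟩ : ∃ r : ℝ, 0 < r ∧ r ≤ x₀' ∧ r ≤ 2 * ε ∧ r ≤ 1 :=
    ⟨min x₀' (min (2*ε) 1), by positivity, min_le_left _ _,
      (min_le_right _ _).trans (min_le_left _ _), (min_le_right _ _).trans (min_le_right _ _)⟩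
  have hh0 : ∀ x ∈ Icc 0 r, 0 ≤ fminv x := by
    intro x hx
    rw [hfminv, ← hgε]; exact hgmono (by linarith [hx.1])
  obtain ⟨M, hM1, hM⟩ := aux_iter φ fminv (1/lam) K R r (max 1 S0) (1/ε*P) hc hK0 hr0
    (by linarith) (le_max_left _ _) (by positivity) hφc hφnn
    (fun x hx => ((le_abs_self _).trans (hS0 x hx)).trans (le_max_right _ _)) hh0
    (by
      intro x hx
      have hx0 := hx.1
      have hx1 : x ≤ 1 := hx.2.trans hr1
      refine (hgK x ⟨hx0, hx1⟩).trans ?_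
      rw [hR]
      calc 1/lam * x * (1 + K * x) ≤ 1/lam * 1 * (1 + K * 1) := by gcongr
        _ = _ := by ring)
    (fun x hx => hgK x ⟨hx.1, hx.2.trans hr1⟩)
    (by
      intro x hx
      rw [hstat x ⟨hx.1, hx.2.trans hrx⟩, mul_assoc, ← intervalIntegral.integral_const_mul P]
      have hmem : ∀ y ∈ Icc 0 (fminv x), x - f y ∈ Icc (-ε) ε := by
        intro y hy
        have h1 : f y ≤ x + ε := by
          have := hfmono.monotone hy.2
          rwa [hfminv, hfg] at this
        have h2 : ε ≤ f y := by rw [← hf0]; exact hfmono.monotone hy.1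
        exact ⟨by linarith, by linarith [hx.2]⟩
      apply mul_le_mul_of_nonneg_left _ (by positivity)
      apply intervalIntegral.integral_mono_on (hh0 x hx)
      · apply ContinuousOn.intervalIntegrable
        rw [uIcc_of_le (hh0 x hx)]
        apply ContinuousOn.mul _ hφc.continuousOn
        exact hp.continuousOn.comp (continuous_const.sub hf.continuous).continuousOn hmem
      · exact (continuous_const.mul hφc).intervalIntegrable _ _
      · intro y hy
        exact mul_le_mul_of_nonneg_right ((le_abs_self _).trans (hP _ (hmem y hy))) (hφnn y))
  obtain ⟨C, hC, d, hd, H⟩ := aux_asymp lam (max 1 S0) M hlam0 hlam1 (le_max_left _ _) hM1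
  refine ⟨C, hC, min d (r/2), ⟨by positivity, (min_le_right _ _).trans_lt (by linarith)⟩, ?_⟩
  intro x hx
  have hxd : x < d := hx.2.trans_le (min_le_left _ _)
  have hxr : x < r / 2 := hx.2.trans_le (min_le_right _ _)
  exact H x ⟨hx.1, hxd⟩ (φ x) (hφpos x ⟨hx.1, by linarith⟩)
    (fun n => hM n x ⟨hx.1.le, by linarith⟩)
end
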